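/- Let n ≥ 2, 0 < λ ≤ Λ and 1 < b₀ ≤ b₁. There exist α ∈ (0,1) and C > 0, depending only on n, λ, Λ, b₀, b₁, with the following property. Let B₁⁺ := {x ∈ ℝⁿ : |x| < 1, x_n > 0}, let b be a constant with b₀ ≤ b ≤ b₁, and let a^{ij} : B₁⁺ → ℝ (1 ≤ i, j ≤ n−1) satisfy λ|ξ'|² ≤ Σ_{i,j=1}^{n−1} a^{ij}(x) ξ_i ξ_j ≤ Λ|ξ'|² for all ξ' ∈ ℝ^{n−1} and x ∈ B₁⁺. If w is a bounded, twice continuously differentiable function on B₁⁺ satisfying ∂_{nn}w(x) + b·∂_n w(x)/x_n + Σ_{i,j=1}^{n−1} a^{ij}(x) ∂_{ij}w(x) = 0 for all x ∈ B₁⁺, then |w(x) − w(y)| ≤ C (sup_{B₁⁺} |w|) |x − y|^α for all x, y ∈ B₁⁺ with |x|, |y| ≤ 1/2. -/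

import Mathlib

open MeasureTheory Set Metric
open scoped RealInnerProductSpace

noncomputable section

/-- The `n`-th standard basis vector `eₙ` of `ℝⁿ`. -/
def eLast (n : ℕ) : EuclideanSpace ℝ (Fin n) :=
  if h : 0 < n then EuclideanSpace.single ⟨n - 1, by omega⟩ 1 else 0

/-- The last coordinate `x_n` of a point of `ℝⁿ`. -/
def lastCoord {n : ℕ} (x : EuclideanSpace ℝ (Fin n)) : ℝ :=
  if h : 0 < n then x ⟨n - 1, by omega⟩ else 0

/-- The `i`-th standard basis vector of `ℝⁿ` for `i ∈ {1, …, n−1}` (tangential directions). -/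
def eTang (n : ℕ) (i : Fin (n - 1)) : EuclideanSpace ℝ (Fin n) :=
  EuclideanSpace.single ⟨i, lt_of_lt_of_le i.isLt (Nat.sub_le n 1)⟩ 1

namespace DegenerateHolder

section LinearAlgebra

variable {ι : Type*} [Fintype ι] [DecidableEq ι]

/-- `(A i j)` is uniformly elliptic with constants `l ≤ L`. -/
structure IsElliptic (l L : ℝ) (A : ι → ι → ℝ) : Prop where
  lower : ∀ ξ : ι → ℝ, l * ∑ i, ξ i ^ 2 ≤ ∑ i, ∑ j, A i j * (ξ i * ξ j)
  upper : ∀ ξ : ι → ℝ, ∑ i, ∑ j, A i j * (ξ i * ξ j) ≤ L * ∑ i, ξ i ^ 2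

open scoped MatrixOrder in
theorem IsElliptic.mul_trace_le {l L : ℝ} {A : ι → ι → ℝ} (hA : IsElliptic l L A)
    {P : Matrix ι ι ℝ} (hP : P.PosSemidef) :
    l * P.trace ≤ ∑ i, ∑ j, A i j * P i j := by
  obtain ⟨B, rfl⟩ := CStarAlgebra.nonneg_iff_eq_star_mul_self.mp hP.nonneg
  rw [Matrix.star_eq_conjTranspose]
  have h1 : (B.conjTranspose * B).trace = ∑ k, ∑ i, B k i ^ 2 := by
    rw [Finset.sum_comm]
    simp [Matrix.trace, Matrix.mul_apply, pow_two]
  have h2 : ∑ i, ∑ j, A i j * (B.conjTranspose * B) i j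
      = ∑ k, ∑ i, ∑ j, A i j * (B k i * B k j) := by
    simp only [Matrix.mul_apply, Matrix.conjTranspose_apply, star_trivial, Finset.mul_sum]
    have : ∀ i, ∑ j, ∑ k, A i j * (B k i * B k j) = ∑ k, ∑ j, A i j * (B k i * B k j) :=
      fun i => Finset.sum_comm
    simp only [this]
    exact Finset.sum_comm
  rw [h1, h2, Finset.mul_sum]
  exact Finset.sum_le_sum fun k _ => hA.lower (B k)

theorem IsElliptic.sum_diag_le {l L : ℝ} {A : ι → ι → ℝ} (hA : IsElliptic l L A) :
    ∑ i, A i i ≤ Fintype.card ι * L := by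
  have : ∀ i, A i i ≤ L := fun i => by
    simpa [Pi.single_apply] using hA.upper (Pi.single i 1)
  simpa using Finset.sum_le_sum fun i (_ : i ∈ Finset.univ) => this i

theorem abs_det_le_of_trace_le {P : Matrix ι ι ℝ} (hP : P.PosSemidef) {c : ℝ}
    (hc : P.trace ≤ c) : |P.det| ≤ c ^ Fintype.card ι := by
  have hnn := hP.eigenvalues_nonneg
  rw [abs_of_nonneg hP.det_nonneg, hP.1.det_eq_prod_eigenvalues]
  rw [hP.1.trace_eq_sum_eigenvalues] at hc
  simp only [RCLike.ofReal_real_eq_id, id_eq] at hc ⊢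
  calc _ ≤ ∏ _i : ι, c := Finset.prod_le_prod (fun i _ => hnn i) fun i _ =>
        (Finset.single_le_sum (fun j _ => hnn j) (Finset.mem_univ i)).trans hc
    _ = _ := by simp

end LinearAlgebra

section SecondOrder

variable {F : Type*} [NormedAddCommGroup F] [NormedSpace ℝ F]

theorem contDiffAt_fderiv_differentiableAt {f : F → ℝ} {x : F} (hf : ContDiffAt ℝ 2 f x) :
    DifferentiableAt ℝ (fderiv ℝ f) x :=
  (hf.fderiv_right (m := 1) (by norm_num)).differentiableAt (by norm_num)

theorem fderiv_fderiv_add {f g : F → ℝ} {x : F} (hf : ContDiffAt ℝ 2 f x)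
    (hg : ContDiffAt ℝ 2 g x) :
    fderiv ℝ (fderiv ℝ (f + g)) x = fderiv ℝ (fderiv ℝ f) x + fderiv ℝ (fderiv ℝ g) x := by
  have h : fderiv ℝ (f + g) =ᶠ[nhds x] fderiv ℝ f + fderiv ℝ g := by
    filter_upwards [hf.eventually (by simp), hg.eventually (by simp)] with y hy hy'
    exact fderiv_add (hy.differentiableAt (by norm_num)) (hy'.differentiableAt (by norm_num))
  rw [h.fderiv_eq]
  exact fderiv_add (contDiffAt_fderiv_differentiableAt hf) (contDiffAt_fderiv_differentiableAt hg)

/-- The second-order necessary condition at a local minimum. -/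
theorem fderiv_fderiv_nonneg_of_isLocalMin {f : F → ℝ} {x : F} (hf : ContDiffAt ℝ 2 f x)
    (hmin : IsLocalMin f x) (ξ : F) : 0 ≤ fderiv ℝ (fderiv ℝ f) x ξ ξ := by
  by_contra! hneg
  set γ : ℝ → F := fun t => x + t • ξ
  have hγ : ∀ t, HasDerivAt γ ξ t := fun t => by
    have h := ((hasDerivAt_id t).smul_const ξ).const_add x
    rwa [one_smul] at h
  have hγ0 : γ 0 = x := by simp [γ]
  have hcont : ContinuousAt γ 0 := (hγ 0).continuousAt
  have hev : ∀ᶠ t in nhds (0 : ℝ), ContDiffAt ℝ 2 f (γ t) :=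
    hcont.eventually (by rw [hγ0]; exact hf.eventually (by simp))
  have hd : deriv (f ∘ γ) =ᶠ[nhds 0] fun t => fderiv ℝ f (γ t) ξ := by
    filter_upwards [hev] with t ht
    exact ((ht.differentiableAt (by norm_num)).hasFDerivAt.comp_hasDerivAt t (hγ t)).deriv
  have hdd : HasDerivAt (fun t => fderiv ℝ f (γ t) ξ) (fderiv ℝ (fderiv ℝ f) x ξ ξ) 0 := by
    have h1 : HasFDerivAt (fderiv ℝ f) (fderiv ℝ (fderiv ℝ f) x) (γ 0) := by
      rw [hγ0]; exact (contDiffAt_fderiv_differentiableAt hf).hasFDerivAt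
    have h2 := h1.comp_hasDerivAt 0 (hγ 0)
    simpa using h2.clm_apply (hasDerivAt_const 0 ξ)
  have hval : deriv (deriv (f ∘ γ)) 0 = fderiv ℝ (fderiv ℝ f) x ξ ξ := by
    rw [hd.deriv_eq, hdd.deriv]
  have hmin' : IsLocalMin (f ∘ γ) 0 := by
    refine IsMinFilter.comp_tendsto (l' := nhds 0) (g := γ) (l := nhds x) ?_ ?_
    · rw [hγ0]; exact hmin
    · rw [← hγ0]; exact hcont
  have hmax := isLocalMax_of_deriv_deriv_neg (by rw [hval]; exact hneg) hmin'.deriv_eq_zero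
    (by refine ContinuousAt.comp ?_ hcont; rw [hγ0]; exact hf.continuousAt)
  have hconst : f ∘ γ =ᶠ[nhds 0] fun _ => (f ∘ γ) 0 := by
    filter_upwards [hmin', hmax] with t h1 h2 using le_antisymm h2 h1
  have h3 : deriv (deriv (f ∘ γ)) 0 = 0 := by
    rw [hconst.deriv.deriv_eq]; simp
  linarith

end SecondOrder

section Operator

variable {ι : Type*} [Fintype ι]

theorem fderiv_radial {g g' : ℝ → ℝ} (hg : ∀ s, 0 ≤ s → HasDerivAt g (g' s) s)
    (y x : EuclideanSpace ℝ ι) :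
    fderiv ℝ (fun z => g (‖z - y‖ ^ 2)) x = (2 * g' (‖x - y‖ ^ 2)) • innerSL ℝ (x - y) := by
  have h1 : HasFDerivAt (fun z : EuclideanSpace ℝ ι => ‖z - y‖ ^ 2)
      (2 • (innerSL ℝ (x - y)).comp (ContinuousLinearMap.id ℝ _)) x :=
    ((hasFDerivAt_id x).sub_const y).norm_sq
  have h2 : HasFDerivAt (fun z => g (‖z - y‖ ^ 2)) _ x :=
    (hg _ (sq_nonneg ‖x - y‖)).comp_hasFDerivAt x h1
  rw [h2.fderiv]
  ext ξ
  simp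
  ring

theorem fderiv_fderiv_radial {g g' g'' : ℝ → ℝ} (hg : ∀ s, 0 ≤ s → HasDerivAt g (g' s) s)
    (hg' : ∀ s, 0 ≤ s → HasDerivAt g' (g'' s) s) (y x ξ ζ : EuclideanSpace ℝ ι) :
    fderiv ℝ (fderiv ℝ (fun z => g (‖z - y‖ ^ 2))) x ξ ζ =
      2 * g' (‖x - y‖ ^ 2) * ⟪ξ, ζ⟫
        + 4 * g'' (‖x - y‖ ^ 2) * (⟪x - y, ξ⟫ * ⟪x - y, ζ⟫) := by
  have h0 : fderiv ℝ (fun z => g (‖z - y‖ ^ 2))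
      = fun x => (2 * g' (‖x - y‖ ^ 2)) • innerSL ℝ (x - y) := funext (fderiv_radial hg y)
  have h1 : HasFDerivAt (fun z : EuclideanSpace ℝ ι => ‖z - y‖ ^ 2)
      (2 • (innerSL ℝ (x - y)).comp (ContinuousLinearMap.id ℝ _)) x :=
    ((hasFDerivAt_id x).sub_const y).norm_sq
  have h2 := ((hg' _ (sq_nonneg ‖x - y‖)).comp_hasFDerivAt x h1).const_mul 2
  have h3 : HasFDerivAt (fun z : EuclideanSpace ℝ ι => innerSL ℝ (z - y)) (innerSL ℝ) x := by
    have := (innerSL ℝ (E := EuclideanSpace ℝ ι)).hasFDerivAt.comp x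
      ((hasFDerivAt_id x).sub_const y)
    exact this
  have h4 : HasFDerivAt (fun x => (2 * g' (‖x - y‖ ^ 2)) • innerSL ℝ (x - y)) _ x := h2.smul h3
  rw [h0, h4.fderiv]
  have h5 : (innerSL ℝ ξ) ζ = ⟪ξ, ζ⟫ := rfl
  simp [inner_sub_left]
  rw [h5]
  ring

variable [DecidableEq ι]

/-- The operator `∑ A i j ∂ᵢⱼ u + b ∂ₖ u / xₖ`. -/
def degOp (k : ι) (A : ι → ι → ℝ) (b : ℝ) (u : EuclideanSpace ℝ ι → ℝ)
    (x : EuclideanSpace ℝ ι) : ℝ :=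
  ∑ i, ∑ j, A i j * fderiv ℝ (fderiv ℝ u) x (EuclideanSpace.single i 1) (EuclideanSpace.single j 1)
    + b * fderiv ℝ u x (EuclideanSpace.single k 1) / x k

theorem degOp_add {k : ι} {A : ι → ι → ℝ} {b : ℝ} {u v : EuclideanSpace ℝ ι → ℝ}
    {x : EuclideanSpace ℝ ι} (hu : ContDiffAt ℝ 2 u x) (hv : ContDiffAt ℝ 2 v x) :
    degOp k A b (u + v) x = degOp k A b u x + degOp k A b v x := by
  unfold degOp
  rw [fderiv_fderiv_add hu hv,
    fderiv_add (hu.differentiableAt (by norm_num)) (hv.differentiableAt (by norm_num))]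
  simp only [add_apply, mul_add, Finset.sum_add_distrib]
  ring

/-- The matrix `I + κ⁻¹ D²v(x)`. -/
def contactMatrix (κ : ℝ) (v : EuclideanSpace ℝ ι → ℝ) (x : EuclideanSpace ℝ ι) : Matrix ι ι ℝ :=
  Matrix.of fun i j => (if i = j then 1 else 0) +
    κ⁻¹ * fderiv ℝ (fderiv ℝ v) x (EuclideanSpace.single i 1) (EuclideanSpace.single j 1)

theorem contact_of_isLocalMin {v : EuclideanSpace ℝ ι → ℝ} {x y : EuclideanSpace ℝ ι} {κ : ℝ}
    (hκ : 0 < κ) (hv : ContDiffAt ℝ 2 v x)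
    (hmin : IsLocalMin (v + fun z => κ / 2 * ‖z - y‖ ^ 2) x) :
    (∀ i, fderiv ℝ v x (EuclideanSpace.single i 1) = κ * (y i - x i)) ∧
      (contactMatrix κ v x).PosSemidef := by
  have hg : ∀ s : ℝ, 0 ≤ s → HasDerivAt (fun s => κ / 2 * s) (κ / 2) s := fun s _ => by
    simpa using (hasDerivAt_id s).const_mul (κ / 2)
  have hg' : ∀ s : ℝ, 0 ≤ s → HasDerivAt (fun _ : ℝ => κ / 2) 0 s := fun s _ =>
    hasDerivAt_const _ _
  have hq : ContDiffAt ℝ 2 (fun z : EuclideanSpace ℝ ι => κ / 2 * ‖z - y‖ ^ 2) x :=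
    contDiffAt_const.mul ((contDiffAt_id.sub contDiffAt_const).norm_sq ℝ)
  constructor
  · intro i
    have h := hmin.fderiv_eq_zero
    rw [fderiv_add (hv.differentiableAt (by norm_num)) (hq.differentiableAt (by norm_num)),
      fderiv_radial (g := fun s => κ / 2 * s) (g' := fun _ => κ / 2) hg y x] at h
    have h := DFunLike.congr_fun h (EuclideanSpace.single i 1)
    simp [EuclideanSpace.inner_single_right] at h
    linarith
  · refine Matrix.PosSemidef.of_dotProduct_mulVec_nonneg ?_ ?_
    · ext i j
      have := hv.isSymmSndFDerivAt (by simp) (EuclideanSpace.single i 1)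
        (EuclideanSpace.single j 1)
      simp [contactMatrix, this, eq_comm]
    · intro ξ
      have h := fderiv_fderiv_nonneg_of_isLocalMin (hv.add hq) hmin (WithLp.toLp 2 ξ)
      change 0 ≤ fderiv ℝ (fderiv ℝ (v + fun z => κ / 2 * ‖z - y‖ ^ 2)) x _ _ at h
      rw [fderiv_fderiv_add hv hq] at h
      simp only [add_apply] at h
      rw [fderiv_fderiv_radial (g := fun s => κ / 2 * s) (g' := fun _ => κ / 2)
        (g'' := fun _ => 0) hg hg'] at h
      have hξ : WithLp.toLp 2 ξ = ∑ i, ξ i • EuclideanSpace.single i (1 : ℝ) := by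
        ext i
        simp [Finset.sum_apply, Pi.single_apply]
      have hn : ⟪WithLp.toLp 2 ξ, WithLp.toLp 2 ξ⟫ = ∑ i, ξ i * ξ i := by
        rw [real_inner_self_eq_norm_sq, EuclideanSpace.real_norm_sq_eq]
        simp [pow_two]
      have e : fderiv ℝ (fderiv ℝ v) x (WithLp.toLp 2 ξ) (WithLp.toLp 2 ξ) =
          ∑ i, ∑ j, ξ i * (ξ j * fderiv ℝ (fderiv ℝ v) x (EuclideanSpace.single i 1)
          (EuclideanSpace.single j 1)) := by
        rw [hξ]
        simp only [map_sum, map_smul, sum_apply, smul_apply, smul_eq_mul, Finset.mul_sum]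
        rw [Finset.sum_comm]
        exact Finset.sum_congr rfl fun i _ => Finset.sum_congr rfl fun j _ => by ring
      rw [hn, e] at h
      have : star ξ ⬝ᵥ ((contactMatrix κ v x).mulVec ξ) = κ⁻¹ *
          (∑ i, ∑ j, ξ i * (ξ j * fderiv ℝ (fderiv ℝ v) x (EuclideanSpace.single i 1)
          (EuclideanSpace.single j 1)) + κ * ∑ i, ξ i * ξ i) := by
        rw [mul_add, ← mul_assoc, inv_mul_cancel₀ hκ.ne', one_mul, Finset.mul_sum,
          ← Finset.sum_add_distrib]
        refine Finset.sum_congr rfl fun i _ => ?_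
        simp [contactMatrix, Matrix.mulVec, dotProduct, add_mul, Finset.sum_add_distrib, mul_add, Finset.mul_sum]
        rw [add_comm]
        congr 1
        exact Finset.sum_congr rfl fun j _ => by ring
      rw [this]
      refine mul_nonneg (inv_nonneg.mpr hκ.le) ?_
      linarith

theorem degOp_rpow_eq_zero {k : ι} {A : ι → ι → ℝ} (hA : A k k = 1) (b ε : ℝ)
    {x : EuclideanSpace ℝ ι} (hx : 0 < x k) :
    degOp k A b (fun z => ε * z k ^ (1 - b)) x = 0 := by
  have h1 : ∀ z : EuclideanSpace ℝ ι, 0 < z k → HasFDerivAt (fun z => ε * z k ^ (1 - b))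
      ((ε * ((1 - b) * z k ^ (1 - b - 1))) • (EuclideanSpace.proj k : EuclideanSpace ℝ ι →L[ℝ] ℝ)) z := by
    intro z hz
    have := ((Real.hasDerivAt_rpow_const (p := 1 - b) (Or.inl hz.ne')).const_mul ε).comp_hasFDerivAt
      z (EuclideanSpace.proj k : EuclideanSpace ℝ ι →L[ℝ] ℝ).hasFDerivAt
    exact this
  have hev : ∀ᶠ z : EuclideanSpace ℝ ι in nhds x, 0 < z k :=
    (EuclideanSpace.proj k : EuclideanSpace ℝ ι →L[ℝ] ℝ).continuous.continuousAt.eventually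
      (lt_mem_nhds hx)
  have h2 : fderiv ℝ (fun z : EuclideanSpace ℝ ι => ε * z k ^ (1 - b)) =ᶠ[nhds x] fun z =>
      (ε * ((1 - b) * z k ^ (1 - b - 1))) • (EuclideanSpace.proj k : EuclideanSpace ℝ ι →L[ℝ] ℝ) :=
    hev.mono fun z hz => (h1 z hz).fderiv
  have h3 : HasFDerivAt (fun z : EuclideanSpace ℝ ι => ε * ((1 - b) * z k ^ (1 - b - 1)))
      ((ε * ((1 - b) * ((1 - b - 1) * x k ^ (1 - b - 1 - 1)))) •
        (EuclideanSpace.proj k : EuclideanSpace ℝ ι →L[ℝ] ℝ)) x := by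
    have := (((Real.hasDerivAt_rpow_const (p := 1 - b - 1) (Or.inl hx.ne')).const_mul
      (1 - b)).const_mul ε).comp_hasFDerivAt
      x (EuclideanSpace.proj k : EuclideanSpace ℝ ι →L[ℝ] ℝ).hasFDerivAt
    exact this
  have h4 := h3.smul_const (EuclideanSpace.proj k : EuclideanSpace ℝ ι →L[ℝ] ℝ)
  unfold degOp
  rw [h2.fderiv_eq, h2.self_of_nhds, h4.fderiv]
  have h5 : x k ^ (1 - b - 1) = x k ^ (1 - b - 1 - 1) * x k := by
    rw [← Real.rpow_add_one hx.ne']; ring_nf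
  have h6 : ∀ (c : ℝ) (i j : ι), (ContinuousLinearMap.smulRight
      (c • (EuclideanSpace.proj k : EuclideanSpace ℝ ι →L[ℝ] ℝ))
        (EuclideanSpace.proj k : EuclideanSpace ℝ ι →L[ℝ] ℝ)) (EuclideanSpace.single i (1 : ℝ))
        (EuclideanSpace.single j (1 : ℝ)) = if i = k then (if j = k then c else 0) else 0 := by
    intro c i j
    by_cases hi : i = k <;> by_cases hj : j = k <;>
      simp [ContinuousLinearMap.smulRight_apply, hi, hj, Ne.symm]
  simp only [h6, h5]
  simp [hA]
  field_simp
  ring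

/-- Upper bound of the operator on an increasing concave radial function. -/
theorem degOp_radial_le {k : ι} {l L b b₁ : ℝ} {A : ι → ι → ℝ} (hA : IsElliptic l L A)
    (hb0 : 0 ≤ b) (hb : b ≤ b₁)
    {g g' g'' : ℝ → ℝ} (hg : ∀ s, 0 ≤ s → HasDerivAt g (g' s) s)
    (hg' : ∀ s, 0 ≤ s → HasDerivAt g' (g'' s) s) (hpos : ∀ s, 0 ≤ s → 0 ≤ g' s)
    (hneg : ∀ s, 0 ≤ s → g'' s ≤ 0) {x y : EuclideanSpace ℝ ι} (hx : 0 < x k) (hy : 0 ≤ y k) :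
    degOp k A b (fun z => g (‖z - y‖ ^ 2)) x ≤
      2 * g' (‖x - y‖ ^ 2) * (Fintype.card ι * L + b₁)
        + 4 * g'' (‖x - y‖ ^ 2) * (l * ‖x - y‖ ^ 2) := by
  have hp := hpos _ (sq_nonneg ‖x - y‖)
  have hn := hneg _ (sq_nonneg ‖x - y‖)
  have hlow := hA.lower (fun i => (x - y) i)
  rw [← EuclideanSpace.real_norm_sq_eq] at hlow
  have hdiag := hA.sum_diag_le
  unfold degOp
  simp only [fderiv_fderiv_radial hg hg', fderiv_radial hg]
  generalize g' (‖x - y‖ ^ 2) = p at *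
  generalize g'' (‖x - y‖ ^ 2) = q at *
  have e1 : ∑ i, ∑ j, A i j * (2 * p * ⟪EuclideanSpace.single i (1:ℝ), EuclideanSpace.single j 1⟫ +
      4 * q * (⟪x - y, EuclideanSpace.single i 1⟫ * ⟪x - y, EuclideanSpace.single j 1⟫))
      = 2 * p * ∑ i, A i i + 4 * q * ∑ i, ∑ j, A i j * ((x - y) i * (x - y) j) := by
    simp only [mul_add, Finset.sum_add_distrib, Finset.mul_sum]
    congr 1
    · refine Finset.sum_congr rfl fun i _ => ?_
      simp [EuclideanSpace.inner_single_right]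
      ring
    · refine Finset.sum_congr rfl fun i _ => Finset.sum_congr rfl fun j _ => ?_
      simp [EuclideanSpace.inner_single_right]
      ring
  rw [e1]
  have e2 : b * ((2 * p) • innerSL ℝ (x - y)) (EuclideanSpace.single k 1) / x k
      = 2 * p * (b * ((x k - y k) / x k)) := by
    simp [EuclideanSpace.inner_single_right]
    ring
  rw [e2]
  have h1 : (x k - y k) / x k ≤ 1 := by
    rw [div_le_one hx]; linarith
  have h2 : b * ((x k - y k) / x k) ≤ b₁ := by nlinarith
  have h3 := mul_le_mul_of_nonneg_left (add_le_add hdiag h2) (by linarith : 0 ≤ 2 * p)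
  have h4 := mul_le_mul_of_nonpos_left hlow (by linarith : 4 * q ≤ 0)
  linarith

end Operator

section Contact

variable {ι : Type*} [Fintype ι] [DecidableEq ι]

theorem contact_trace_le {v : EuclideanSpace ℝ ι → ℝ} {x y : EuclideanSpace ℝ ι} {κ l L b D : ℝ}
    {k : ι} {A : ι → ι → ℝ} (hA : IsElliptic l L A) (hκ : 0 < κ) (hx : 0 < x k)
    (hgrad : ∀ i, fderiv ℝ v x (EuclideanSpace.single i 1) = κ * (y i - x i))
    (hP : (contactMatrix κ v x).PosSemidef) (hD : degOp k A b v x ≤ D) :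
    l * (contactMatrix κ v x).trace + b * (y k / x k) ≤ Fintype.card ι * L + b + D / κ := by
  have h1 := hA.mul_trace_le hP
  have h2 : ∑ i, ∑ j, A i j * contactMatrix κ v x i j = ∑ i, A i i + κ⁻¹ * ∑ i, ∑ j, A i j *
      fderiv ℝ (fderiv ℝ v) x (EuclideanSpace.single i 1) (EuclideanSpace.single j 1) := by
    simp only [Finset.mul_sum, ← Finset.sum_add_distrib]
    refine Finset.sum_congr rfl fun i _ => ?_
    simp only [contactMatrix, Matrix.of_apply, mul_add, Finset.sum_add_distrib]
    congr 1
    · simp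
    · exact Finset.sum_congr rfl fun j _ => by ring
  have h3 : b * (y k / x k) = b + κ⁻¹ * (b * fderiv ℝ v x (EuclideanSpace.single k 1) / x k) := by
    rw [hgrad]; field_simp; ring
  have h4 := hA.sum_diag_le
  have h5 : κ⁻¹ * degOp k A b v x ≤ D / κ := by
    rw [div_eq_inv_mul]; exact mul_le_mul_of_nonneg_left hD (inv_nonneg.mpr hκ.le)
  unfold degOp at h5
  rw [mul_add] at h5
  linarith

/-- The map sending a contact point to the vertex of the touching paraboloid. -/
def vertexMap (κ : ℝ) (v : EuclideanSpace ℝ ι → ℝ) (x : EuclideanSpace ℝ ι) :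
    EuclideanSpace ℝ ι :=
  WithLp.toLp 2 fun i => x i + κ⁻¹ * fderiv ℝ v x (EuclideanSpace.single i 1)

theorem hasFDerivAt_vertexMap {κ : ℝ} {v : EuclideanSpace ℝ ι → ℝ} {x : EuclideanSpace ℝ ι}
    (hv : ContDiffAt ℝ 2 v x) :
    HasFDerivAt (vertexMap κ v) (fderiv ℝ (vertexMap κ v) x) x ∧
      (fderiv ℝ (vertexMap κ v) x).det = (contactMatrix κ v x).det := by
  have hc : ∀ i, HasFDerivAt (fun z => vertexMap κ v z i)
      ((EuclideanSpace.proj i : EuclideanSpace ℝ ι →L[ℝ] ℝ) +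
        κ⁻¹ • ((fderiv ℝ (fderiv ℝ v) x).flip (EuclideanSpace.single i 1))) x := by
    intro i
    have h1 := (contDiffAt_fderiv_differentiableAt hv).hasFDerivAt.clm_apply
      (hasFDerivAt_const (EuclideanSpace.single i (1 : ℝ)) x)
    have h2 := ((EuclideanSpace.proj i : EuclideanSpace ℝ ι →L[ℝ] ℝ).hasFDerivAt (x := x)).add
      (h1.const_mul κ⁻¹)
    refine h2.congr_fderiv ?_
    ext ξ
    simp
  have hd : DifferentiableAt ℝ (vertexMap κ v) x :=
    (differentiableAt_euclidean).mpr fun i => (hc i).differentiableAt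
  refine ⟨hd.hasFDerivAt, ?_⟩
  have hval : ∀ i j, (fderiv ℝ (vertexMap κ v) x (EuclideanSpace.single j 1)) i
      = contactMatrix κ v x j i := by
    intro i j
    have h1 := (EuclideanSpace.proj i : EuclideanSpace ℝ ι →L[ℝ] ℝ).hasFDerivAt.comp x
      hd.hasFDerivAt
    have h2 := h1.unique (hc i)
    have h3 := DFunLike.congr_fun h2 (EuclideanSpace.single j (1 : ℝ))
    simp at h3
    rw [h3]
    simp [contactMatrix, eq_comm]
  rw [ContinuousLinearMap.det,
    ← LinearMap.det_toMatrix (EuclideanSpace.basisFun ι ℝ).toBasis, ← Matrix.det_transpose]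
  congr 1
  ext i j
  simp [LinearMap.toMatrix_apply, hval]

theorem exists_barrier {l C₀ : ℝ} (hl : 0 < l) (hC₀ : 0 < C₀) :
    ∃ A κ₀ D : ℝ, 0 < κ₀ ∧ κ₀ ≤ 2 / 25 ∧ 0 < D ∧ ∀ r : ℝ, 0 < r → ∃ g g' g'' : ℝ → ℝ,
      (∀ s, 0 ≤ s → ContDiffAt ℝ 2 g s) ∧
      (∀ s, 0 ≤ s → HasDerivAt g (g' s) s) ∧ (∀ s, 0 ≤ s → HasDerivAt g' (g'' s) s) ∧
      (∀ s, 0 ≤ s → 0 ≤ g' s) ∧ (∀ s, 0 ≤ s → g'' s ≤ 0) ∧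
      (∀ s, 0 ≤ s → s ≤ 16 * r ^ 2 → g s ≤ -4) ∧ g (36 * r ^ 2) = 0 ∧ (∀ s, 0 ≤ s → -A ≤ g s) ∧
      (∀ s, r ^ 2 ≤ s → s ≤ 36 * r ^ 2 →
        2 * g' s * C₀ + 4 * g'' s * (l * s) ≤ -(C₀ * (κ₀ / r ^ 2))) ∧
      (∀ s, 0 ≤ s → 2 * g' s * C₀ + 4 * g'' s * (l * s) ≤ D / r ^ 2) := by
  obtain ⟨p, hp⟩ := exists_nat_ge (2 * C₀ / l)
  have hp' : 2 * C₀ ≤ (p + 1) * l := by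
    rw [div_le_iff₀ hl] at hp; linarith
  have hp0 : 0 < p := by
    rcases Nat.eq_zero_or_pos p with h | h
    · subst h
      have : 0 < 2 * C₀ / l := by positivity
      simp at hp; linarith
    · exact h
  have hpR : (0 : ℝ) < p := by exact_mod_cast hp0
  have hgap : (0 : ℝ) < (17 ^ p)⁻¹ - (37 ^ p)⁻¹ := by
    rw [sub_pos]
    exact inv_strictAnti₀ (by positivity) (pow_lt_pow_left₀ (by norm_num) (by norm_num) hp0.ne')
  set A : ℝ := 4 / ((17 ^ p)⁻¹ - (37 ^ p)⁻¹) with hAdef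
  have hA : 0 < A := by positivity
  have hA4 : A * ((17 ^ p)⁻¹ - (37 ^ p)⁻¹) = 4 := by rw [hAdef, div_mul_cancel₀ _ hgap.ne']
  refine ⟨A, min (2 * A * p * (37 ^ (p + 1))⁻¹) (2 / 25), 2 * A * p * C₀, by positivity,
    min_le_right _ _, by positivity, fun r hr => ?_⟩
  have hσ : ∀ s : ℝ, 0 ≤ s → 0 < s / r ^ 2 + 1 := fun s hs => by positivity
  have hdσ : ∀ s : ℝ, HasDerivAt (fun s : ℝ => s / r ^ 2 + 1) (1 / r ^ 2) s := fun s =>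
    ((hasDerivAt_id s).div_const _).add_const _
  have hinv : ∀ (q : ℕ) (s : ℝ), 0 ≤ s → HasDerivAt (fun s : ℝ => ((s / r ^ 2 + 1) ^ (q + 1))⁻¹)
      (-((q + 1) / r ^ 2 * ((s / r ^ 2 + 1) ^ (q + 2))⁻¹)) s := by
    intro q s hs
    have h := ((hdσ s).pow (q + 1)).inv (pow_ne_zero _ (hσ s hs).ne')
    refine h.congr_deriv ?_
    have := hσ s hs
    simp only [Pi.pow_apply]
    generalize s / r ^ 2 + 1 = σ at *
    push_cast
    field_simp
    ring
  obtain ⟨q, rfl⟩ : ∃ q, p = q + 1 := ⟨p - 1, by omega⟩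
  refine ⟨fun s => A * ((37 ^ (q + 1))⁻¹ - ((s / r ^ 2 + 1) ^ (q + 1))⁻¹),
    fun s => A * ((q + 1) / r ^ 2 * ((s / r ^ 2 + 1) ^ (q + 2))⁻¹),
    fun s => -(A * ((q + 1) / r ^ 2 * ((q + 2) / r ^ 2 * ((s / r ^ 2 + 1) ^ (q + 3))⁻¹))),
    ?_, ?_, ?_, ?_, ?_, ?_, ?_, ?_, ?_, ?_⟩
  · intro s hs
    refine contDiffAt_const.mul (contDiffAt_const.sub (ContDiffAt.inv ?_ ?_))
    · fun_prop
    · exact pow_ne_zero _ (hσ s hs).ne'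
  · intro s hs
    refine (((hinv q s hs).const_sub _).const_mul A).congr_deriv ?_
    ring
  · intro s hs
    refine (((hinv (q + 1) s hs).const_mul ((q + 1) / r ^ 2)).const_mul A).congr_deriv ?_
    push_cast
    ring
  · intro s hs
    have := hσ s hs
    positivity
  · intro s hs
    have := hσ s hs
    have : 0 ≤ A * ((q + 1) / r ^ 2 * ((q + 2) / r ^ 2 * ((s / r ^ 2 + 1) ^ (q + 3))⁻¹)) := by
      positivity
    linarith
  · intro s hs hs'
    have h0 := hσ s hs
    have h1 : s / r ^ 2 + 1 ≤ 17 := by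
      have : s / r ^ 2 ≤ 16 := by rw [div_le_iff₀ (by positivity)]; exact hs'
      linarith
    have h2 : ((17 : ℝ) ^ (q + 1))⁻¹ ≤ ((s / r ^ 2 + 1) ^ (q + 1))⁻¹ :=
      inv_anti₀ (by positivity) (pow_le_pow_left₀ h0.le h1 _)
    have h3 := mul_le_mul_of_nonneg_left h2 hA.le
    have h4 : A * ((17 ^ (q + 1))⁻¹) - A * (37 ^ (q + 1))⁻¹ = 4 := by rw [← hA4]; ring
    simp only [mul_sub]
    linarith
  · have : 36 * r ^ 2 / r ^ 2 + 1 = 37 := by field_simp; norm_num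
    simp [this]
  · intro s hs
    have h0 := hσ s hs
    have h1 : 1 ≤ s / r ^ 2 + 1 := by linarith [show 0 ≤ s / r ^ 2 by positivity]
    have h2 : ((s / r ^ 2 + 1) ^ (q + 1))⁻¹ ≤ 1 := inv_le_one_of_one_le₀ (one_le_pow₀ h1)
    have h3 := mul_le_mul_of_nonneg_left h2 hA.le
    have h4 : 0 ≤ A * (37 ^ (q + 1))⁻¹ := by positivity
    simp only [mul_sub]
    linarith
  · intro s hs hs'
    have hs0 : 0 ≤ s := (sq_nonneg r).trans hs
    have h0 := hσ s hs0
    have h1 : 1 ≤ s / r ^ 2 := by rw [le_div_iff₀ (by positivity)]; linarith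
    have h2 : s / r ^ 2 + 1 ≤ 37 := by
      have : s / r ^ 2 ≤ 36 := by rw [div_le_iff₀ (by positivity)]; exact hs'
      linarith
    have hsr : s = (s / r ^ 2) * r ^ 2 := by field_simp
    have hmin : min (2 * A * (q + 1 : ℕ) * (37 ^ (q + 1 + 1))⁻¹) (2 / 25)
        ≤ 2 * A * (q + 1) * (37 ^ (q + 1 + 1))⁻¹ := by
      refine (min_le_left _ _).trans (le_of_eq (by push_cast; ring))
    set m := min (2 * A * (q + 1 : ℕ) * (37 ^ (q + 1 + 1) : ℝ)⁻¹) (2 / 25)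
    set τ := s / r ^ 2 with hτ
    have e : 2 * (A * ((q + 1) / r ^ 2 * ((τ + 1) ^ (q + 2))⁻¹)) * C₀ +
        4 * -(A * ((q + 1) / r ^ 2 * ((q + 2) / r ^ 2 * ((τ + 1) ^ (q + 3))⁻¹))) * (l * s)
        = A * (q + 1) / r ^ 2 * ((τ + 1) ^ (q + 2))⁻¹ *
          (2 * C₀ - 4 * ((q + 2) * l) * (τ / (τ + 1))) := by
      rw [hsr]
      field_simp
      ring
    rw [e]
    have h3 : 1 / 2 ≤ τ / (τ + 1) := by rw [le_div_iff₀ h0]; linarith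
    have h4 : 2 * C₀ ≤ (q + 2) * l := by push_cast at hp'; linarith
    have h5 : 2 * C₀ - 4 * ((q + 2) * l) * (τ / (τ + 1)) ≤ -(2 * C₀) := by nlinarith
    have h6 : ((37 : ℝ) ^ (q + 2))⁻¹ ≤ ((τ + 1) ^ (q + 2))⁻¹ :=
      inv_anti₀ (by positivity) (pow_le_pow_left₀ h0.le h2 _)
    calc _ ≤ A * (q + 1) / r ^ 2 * ((τ + 1) ^ (q + 2))⁻¹ * (-(2 * C₀)) :=
          mul_le_mul_of_nonneg_left h5 (by positivity)
      _ ≤ A * (q + 1) / r ^ 2 * ((37 : ℝ) ^ (q + 2))⁻¹ * (-(2 * C₀)) :=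
          mul_le_mul_of_nonpos_right (mul_le_mul_of_nonneg_left h6 (by positivity)) (by linarith)
      _ = -(C₀ * ((2 * A * (q + 1) * (37 ^ (q + 1 + 1))⁻¹) / r ^ 2)) := by ring
      _ ≤ _ := neg_le_neg (by gcongr)
  · intro s hs
    have h0 := hσ s hs
    have h1 : 1 ≤ s / r ^ 2 + 1 := by linarith [show 0 ≤ s / r ^ 2 by positivity]
    have h2 : ((s / r ^ 2 + 1) ^ (q + 2))⁻¹ ≤ 1 := inv_le_one_of_one_le₀ (one_le_pow₀ h1)
    have h3 : 0 ≤ 4 * (A * ((q + 1) / r ^ 2 * ((q + 2) / r ^ 2 * ((s / r ^ 2 + 1) ^ (q + 3))⁻¹)))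
        * (l * s) := by positivity
    have h4 : 2 * (A * ((q + 1) / r ^ 2 * ((s / r ^ 2 + 1) ^ (q + 2))⁻¹)) * C₀
        ≤ 2 * (A * ((q + 1) / r ^ 2 * 1)) * C₀ := by gcongr
    have h5 : 2 * (A * ((q + 1) / r ^ 2 * 1)) * C₀ = 2 * A * (q + 1 : ℕ) * C₀ / r ^ 2 := by
      push_cast; ring
    linarith

end Contact

theorem isOpen_pos_coord {ι : Type*} (k : ι) : IsOpen {x : EuclideanSpace ℝ ι | 0 < x k} :=
  isOpen_lt continuous_const (EuclideanSpace.proj k : EuclideanSpace ℝ ι →L[ℝ] ℝ).continuous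

theorem measurableSet_sep_le_of_continuousOn {X : Type*} [TopologicalSpace X]
    [MeasurableSpace X] [BorelSpace X] {U : Set X} (hU : IsOpen U) {f : X → ℝ}
    (hf : ContinuousOn f U) (c : ℝ) : MeasurableSet {x ∈ U | f x ≤ c} := by
  have : {x ∈ U | f x ≤ c} = U \ (U ∩ f ⁻¹' Ioi c) := by
    ext x; simp
  rw [this]
  exact hU.measurableSet.diff (hf.isOpen_inter_preimage hU isOpen_Ioi).measurableSet

section Balls

variable {ι : Type*} [Fintype ι]

theorem apply_le_of_mem_closedBall {k : ι} {x y : EuclideanSpace ℝ ι} {r : ℝ}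
    (h : y ∈ closedBall x r) : x k - r ≤ y k ∧ y k ≤ x k + r := by
  rw [mem_closedBall, dist_eq_norm] at h
  have h1 := (PiLp.norm_apply_le (y - x) k).trans h
  rw [Real.norm_eq_abs] at h1
  have h2 := abs_le.mp h1
  simp only [PiLp.sub_apply] at h2
  constructor <;> linarith

theorem mem_shiftedBall [DecidableEq ι] {k : ι} {x y : EuclideanSpace ℝ ι} {r : ℝ} (hr : 0 < r) (hx : 0 < x k)
    (hy : y ∈ closedBall (x + EuclideanSpace.single k (r / 2)) (r / 4)) :
    y ∈ closedBall x r ∧ (x k + r) / 4 ≤ y k := by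
  constructor
  · rw [mem_closedBall, dist_eq_norm] at hy ⊢
    have h1 : y - x = (y - (x + EuclideanSpace.single k (r / 2)))
        + EuclideanSpace.single k (r / 2) := by abel
    rw [h1]
    refine (norm_add_le _ _).trans ?_
    rw [PiLp.norm_single, Real.norm_eq_abs, abs_of_pos (by positivity)]
    linarith
  · have h2 := (apply_le_of_mem_closedBall (k := k) hy).1
    simp at h2
    linarith

end Balls

section Measure

variable {ι : Type*} [Fintype ι] [DecidableEq ι]

/-- `∑ A i j ∂ᵢⱼ u + b ∂ₖ u / xₖ ≤ 0` at `x` for some elliptic `A` with `A k k = 1`. -/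
def IsSupersolutionAt (k : ι) (l L b : ℝ) (u : EuclideanSpace ℝ ι → ℝ)
    (x : EuclideanSpace ℝ ι) : Prop :=
  ∃ A : ι → ι → ℝ, IsElliptic l L A ∧ A k k = 1 ∧ degOp k A b u x ≤ 0

theorem continuousOn_det_contactMatrix {κ : ℝ} {v : EuclideanSpace ℝ ι → ℝ}
    {U : Set (EuclideanSpace ℝ ι)} (hv : ∀ x ∈ U, ContDiffAt ℝ 2 v x) :
    ContinuousOn (fun x => (contactMatrix κ v x).det) U := by
  refine continuous_id.matrix_det.comp_continuousOn ?_
  refine continuousOn_pi.mpr fun i => continuousOn_pi.mpr fun j => fun x hx => ?_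
  have h : ContinuousAt (fderiv ℝ (fderiv ℝ v)) x :=
    (((hv x hx).fderiv_right (m := 1) (by norm_num)).fderiv_right (m := 0)
      (by norm_num)).continuousAt
  refine ContinuousAt.continuousWithinAt ?_
  simp only [Matrix.of_apply]
  fun_prop

set_option maxHeartbeats 1000000 in
/-- Existence of a contact point below the touching paraboloid with vertex `y`. -/
theorem exists_contact_point {k : ι} {l L b b₁ A κ₀ D C₂ r : ℝ} {g g' g'' : ℝ → ℝ}
    {u v : EuclideanSpace ℝ ι → ℝ} {x₀ x₁ y : EuclideanSpace ℝ ι}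
    (hl : 0 < l) (hb : 1 < b) (hb' : b ≤ b₁) (hκ₀ : 0 < κ₀)
    (hκ₀' : κ₀ ≤ 2 / 25) (hD : 0 < D) (hr : 0 < r)
    (hC₀ : 0 < Fintype.card ι * L + b₁) (hC₂ : C₂ = Fintype.card ι * L + b₁ + D / κ₀)
    (hg : ∀ s, 0 ≤ s → HasDerivAt g (g' s) s) (hg' : ∀ s, 0 ≤ s → HasDerivAt g' (g'' s) s)
    (hpos : ∀ s, 0 ≤ s → 0 ≤ g' s) (hneg : ∀ s, 0 ≤ s → g'' s ≤ 0)
    (hin : ∀ s, 0 ≤ s → s ≤ 16 * r ^ 2 → g s ≤ -4) (hout : g (36 * r ^ 2) = 0)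
    (hlow : ∀ s, 0 ≤ s → -A ≤ g s) (hA : 1 ≤ A)
    (hsup : ∀ s, r ^ 2 ≤ s → s ≤ 36 * r ^ 2 → 2 * g' s * (Fintype.card ι * L + b₁)
      + 4 * g'' s * (l * s) ≤ -((Fintype.card ι * L + b₁) * (κ₀ / r ^ 2)))
    (hsup' : ∀ s, 0 ≤ s → 2 * g' s * (Fintype.card ι * L + b₁)
      + 4 * g'' s * (l * s) ≤ D / r ^ 2)
    (hx₀ : 0 < x₀ k)
    (hu0 : ∀ x ∈ ball x₀ (7 * r) ∩ {x | 0 < x k}, 0 ≤ u x)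
    (hsol : ∀ x ∈ ball x₀ (7 * r) ∩ {x | 0 < x k}, IsSupersolutionAt k l L b u x)
    (hu2 : ∀ x ∈ ball x₀ (7 * r) ∩ {x | 0 < x k}, ContDiffAt ℝ 2 u x)
    (hg2 : ∀ x, ContDiffAt ℝ 2 (fun z : EuclideanSpace ℝ ι => g (‖z - x₀‖ ^ 2)) x)
    (hp2 : ∀ x ∈ ball x₀ (7 * r) ∩ {x | 0 < x k}, ContDiffAt ℝ 2
      (fun z : EuclideanSpace ℝ ι => x₁ k ^ (b - 1) * z k ^ (1 - b)) x)
    (hx₁ : x₁ ∈ closedBall x₀ (4 * r)) (hx₁k : 0 < x₁ k) (hux₁ : u x₁ ≤ 1)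
    (hv : v = u + ((fun z => x₁ k ^ (b - 1) * z k ^ (1 - b)) + fun z => g (‖z - x₀‖ ^ 2)))
    (hy : y ∈ closedBall x₀ r) (hyk : (x₀ k + r) / 4 ≤ y k) :
    ∃ x ∈ closedBall x₀ r, 0 < x k ∧ u x ≤ A ∧ (x₀ k + r) / (4 * C₂) ≤ x k ∧
      |(contactMatrix (κ₀ / r ^ 2) v x).det| ≤ (C₂ / l) ^ Fintype.card ι ∧
      vertexMap (κ₀ / r ^ 2) v x = y := by
  set κ := κ₀ / r ^ 2 with hκdef
  have hκ : 0 < κ := by positivity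
  set ε := x₁ k ^ (b - 1) with hε
  have hεpos : 0 < ε := Real.rpow_pos_of_pos hx₁k _
  have hykpos : 0 < y k := lt_of_lt_of_le (by positivity) hyk
  have hbb : 0 < b - 1 := by linarith
  set η := x₁ k * A ^ (-(1 / (b - 1))) with hη
  have hηpos : 0 < η := mul_pos hx₁k (Real.rpow_pos_of_pos (by linarith) _)
  have hηle : η ≤ x₁ k := by
    refine mul_le_of_le_one_right hx₁k.le (Real.rpow_le_one_of_one_le_of_nonpos hA ?_)
    exact neg_nonpos.mpr (by positivity)
  have hε1 : ε * x₁ k ^ (1 - b) = 1 := by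
    rw [hε, ← Real.rpow_add hx₁k]; simp
  have hεη : ε * η ^ (1 - b) = A := by
    rw [hη, Real.mul_rpow hx₁k.le (Real.rpow_nonneg (by linarith) _), ← Real.rpow_mul (by linarith),
      ← mul_assoc, hε1]
    have : -(1 / (b - 1)) * (1 - b) = 1 := by field_simp; ring
    rw [this]; simp
  have hcoord : Continuous fun z : EuclideanSpace ℝ ι => z k :=
    (EuclideanSpace.proj k : EuclideanSpace ℝ ι →L[ℝ] ℝ).continuous
  set U := ball x₀ (7 * r) ∩ {x : EuclideanSpace ℝ ι | 0 < x k} with hU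
  have hv2 : ∀ x ∈ U, ContDiffAt ℝ 2 v x := fun x hx => by
    rw [hv]; exact (hu2 x hx).add ((hp2 x hx).add (hg2 x))
  set K := closedBall x₀ (6 * r) ∩ {z : EuclideanSpace ℝ ι | η ≤ z k} with hK
  have hKU : K ⊆ U := fun z hz =>
    ⟨closedBall_subset_ball (by linarith) hz.1, lt_of_lt_of_le hηpos hz.2⟩
  have hKc : IsCompact K :=
    (isCompact_closedBall x₀ (6 * r)).inter_right (isClosed_le continuous_const hcoord)
  have hx₁K : x₁ ∈ K := ⟨closedBall_subset_closedBall (by linarith) hx₁, hηle⟩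
  set Φ : EuclideanSpace ℝ ι → ℝ := v + fun z => κ / 2 * ‖z - y‖ ^ 2 with hΦ
  have hΦc : ContinuousOn Φ K := by
    intro z hz
    refine ((hv2 z (hKU hz)).continuousAt.add ?_).continuousWithinAt
    fun_prop
  obtain ⟨x, hxK, hxmin⟩ := hKc.exists_isMinOn ⟨x₁, hx₁K⟩ hΦc
  have hxU := hKU hxK
  have hxk : 0 < x k := hxU.2
  have hΦval : ∀ z, Φ z = u z + (ε * z k ^ (1 - b) + g (‖z - x₀‖ ^ 2)) + κ / 2 * ‖z - y‖ ^ 2 := by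
    intro z; rw [hΦ, hv]; rfl
  have hΦx₁ : Φ x₁ < 0 := by
    rw [hΦval, hε1]
    have h1 : ‖x₁ - x₀‖ ≤ 4 * r := by rwa [mem_closedBall, dist_eq_norm] at hx₁
    have h2 : g (‖x₁ - x₀‖ ^ 2) ≤ -4 := by
      refine hin _ (sq_nonneg _) ?_
      exact (pow_le_pow_left₀ (norm_nonneg _) h1 2).trans_eq (by ring)
    have h3 : ‖x₁ - y‖ ≤ 5 * r := by
      rw [← dist_eq_norm]
      rw [mem_closedBall] at hx₁ hy
      linarith [dist_triangle_right x₁ y x₀]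
    have h4 : κ / 2 * ‖x₁ - y‖ ^ 2 ≤ κ / 2 * (5 * r) ^ 2 := by gcongr
    have h5 : κ / 2 * (5 * r) ^ 2 = 25 / 2 * κ₀ := by rw [hκdef]; field_simp; norm_num
    linarith
  have hΦx : Φ x < 0 := lt_of_le_of_lt (hxmin hx₁K) hΦx₁
  have hΦx' := hΦx
  rw [hΦval] at hΦx'
  have hux := hu0 x hxU
  have hq0 : 0 ≤ κ / 2 * ‖x - y‖ ^ 2 := by positivity
  have hp0 : 0 < ε * x k ^ (1 - b) := mul_pos hεpos (Real.rpow_pos_of_pos hxk _)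
  have hgA := hlow _ (sq_nonneg ‖x - x₀‖)
  have hxlt : x ∈ ball x₀ (6 * r) := by
    refine mem_ball.mpr (lt_of_le_of_ne (mem_closedBall.mp hxK.1) fun h => ?_)
    rw [dist_eq_norm] at h
    rw [h, show (6 * r) ^ 2 = 36 * r ^ 2 by ring, hout] at hΦx'
    linarith
  have hηlt : η < x k := by
    refine lt_of_le_of_ne (show η ≤ x k from hxK.2) fun h => ?_
    rw [← h, hεη] at hΦx'
    linarith
  have hloc : IsLocalMin Φ x := by
    refine hxmin.isLocalMin (Filter.mem_of_superset (((isOpen_ball).inter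
      (isOpen_lt continuous_const hcoord)).mem_nhds ⟨hxlt, hηlt⟩) fun z hz => ?_)
    have hz2 : η < z k := hz.2
    exact ⟨ball_subset_closedBall hz.1, hz2.le⟩
  obtain ⟨hgrad, hP⟩ := contact_of_isLocalMin hκ (hv2 x hxU) hloc
  obtain ⟨a, ha, hakk, hale⟩ := hsol x hxU
  have hdeg : degOp k a b v x ≤ 2 * g' (‖x - x₀‖ ^ 2) * (Fintype.card ι * L + b₁)
        + 4 * g'' (‖x - x₀‖ ^ 2) * (l * ‖x - x₀‖ ^ 2) := by
    have hpg : ContDiffAt ℝ 2 ((fun z : EuclideanSpace ℝ ι => ε * z k ^ (1 - b)) +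
        fun z => g (‖z - x₀‖ ^ 2)) x := (hp2 x hxU).add (hg2 x)
    rw [hv, degOp_add (hu2 x hxU) hpg, degOp_add (hp2 x hxU) (hg2 x),
      degOp_rpow_eq_zero hakk b ε hxk]
    have := degOp_radial_le ha (by linarith) hb' hg hg' hpos hneg hxk hx₀.le
    linarith
  have htr := contact_trace_le ha hκ hxk hgrad hP hdeg
  have htr0 := hP.trace_nonneg
  have hquot : 0 < y k / x k := div_pos hykpos hxk
  have hltr : 0 ≤ l * (contactMatrix κ v x).trace := mul_nonneg hl.le htr0
  have hbq : y k / x k ≤ b * (y k / x k) := le_mul_of_one_le_left hquot.le hb.le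
  have hxr : x ∈ closedBall x₀ r := by
    by_contra hcon
    rw [mem_closedBall, dist_eq_norm, not_le] at hcon
    rw [mem_ball, dist_eq_norm] at hxlt
    have h1 := hsup (‖x - x₀‖ ^ 2) (pow_le_pow_left₀ hr.le hcon.le 2)
      ((pow_le_pow_left₀ (norm_nonneg _) hxlt.le 2).trans_eq (by ring))
    have h2 := div_le_div_of_nonneg_right h1 hκ.le
    rw [neg_div, mul_div_assoc, div_self hκ.ne', mul_one] at h2
    linarith
  have hC₂bd : l * (contactMatrix κ v x).trace + b * (y k / x k) ≤ C₂ := by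
    have h1 := div_le_div_of_nonneg_right (hsup' (‖x - x₀‖ ^ 2) (sq_nonneg _)) hκ.le
    have h2 : D / r ^ 2 / κ = D / κ₀ := by rw [hκdef]; field_simp
    rw [h2] at h1
    linarith
  have hC₂pos : 0 < C₂ := by rw [hC₂]; positivity
  refine ⟨x, hxr, hxk, by linarith, ?_, ?_, ?_⟩
  · have h1 : y k / x k ≤ C₂ := by linarith
    rw [div_le_iff₀ hxk] at h1
    rw [div_le_iff₀ (by positivity)]
    linarith
  · refine abs_det_le_of_trace_le hP ?_
    rw [le_div_iff₀ hl]; linarith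
  · ext i
    simp only [vertexMap, hgrad]
    field_simp
    ring

set_option maxHeartbeats 1000000 in
theorem exists_contact_constants (k : ι) {l L b₁ : ℝ} (hl : 0 < l) (hL : 0 < L) (hb₁ : 1 < b₁) :
    ∃ A C : ℝ, 1 < A ∧ 1 ≤ C ∧ ∀ (b : ℝ) (u : EuclideanSpace ℝ ι → ℝ)
      (x₀ x₁ : EuclideanSpace ℝ ι) (r : ℝ), 1 < b → b ≤ b₁ → 0 < r → 0 < x₀ k →
      ContDiffOn ℝ 2 u (ball x₀ (7 * r) ∩ {x | 0 < x k}) →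
      (∀ x ∈ ball x₀ (7 * r) ∩ {x | 0 < x k}, 0 ≤ u x) →
      (∀ x ∈ ball x₀ (7 * r) ∩ {x | 0 < x k}, IsSupersolutionAt k l L b u x) →
      x₁ ∈ closedBall x₀ (4 * r) → 0 < x₁ k → u x₁ ≤ 1 →
      volume (closedBall (x₀ + EuclideanSpace.single k (r / 2)) (r / 4)) ≤ ENNReal.ofReal C *
        volume {x ∈ closedBall x₀ r | 0 < x k ∧ u x ≤ A ∧ (x₀ k + r) / C ≤ x k} := by
  have hC₀ : 0 < Fintype.card ι * L + b₁ := by positivity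
  obtain ⟨A, κ₀, D, hκ₀, hκ₀', hD, hbar⟩ := exists_barrier hl hC₀
  have hA : 4 ≤ A := by
    obtain ⟨g, -, -, -, -, -, -, -, h1, -, h2, -⟩ := hbar 1 one_pos
    linarith [h1 0 le_rfl (by norm_num), h2 0 le_rfl]
  set C₂ := Fintype.card ι * L + b₁ + D / κ₀ with hC₂
  have hC₂1 : 1 ≤ C₂ := by
    have : 0 ≤ Fintype.card ι * L + D / κ₀ := by positivity
    linarith
  refine ⟨A, max (4 * C₂) ((C₂ / l) ^ Fintype.card ι), by linarith,
    le_max_of_le_left (by linarith), ?_⟩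
  intro b u x₀ x₁ r hb hb' hr hx₀ hu2 hu0 hsol hx₁ hx₁k hux₁
  obtain ⟨g, g', g'', hg2, hg, hg', hpos, hneg, hin, hout, hlow, hsup, hsup'⟩ := hbar r hr
  have hUo : IsOpen (ball x₀ (7 * r) ∩ {x : EuclideanSpace ℝ ι | 0 < x k}) :=
    isOpen_ball.inter (isOpen_pos_coord k)
  have hu2' : ∀ x ∈ ball x₀ (7 * r) ∩ {x | 0 < x k}, ContDiffAt ℝ 2 u x := fun x hx =>
    hu2.contDiffAt (hUo.mem_nhds hx)
  have hg2' : ∀ x, ContDiffAt ℝ 2 (fun z : EuclideanSpace ℝ ι => g (‖z - x₀‖ ^ 2)) x := fun x =>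
    (hg2 _ (sq_nonneg ‖x - x₀‖)).comp x ((contDiffAt_id.sub contDiffAt_const).norm_sq ℝ)
  have hp2 : ∀ x ∈ ball x₀ (7 * r) ∩ {x | 0 < x k}, ContDiffAt ℝ 2
      (fun z : EuclideanSpace ℝ ι => x₁ k ^ (b - 1) * z k ^ (1 - b)) x := fun x hx =>
    contDiffAt_const.mul (((EuclideanSpace.proj k : EuclideanSpace ℝ ι →L[ℝ]
      ℝ).contDiff.contDiffAt).rpow_const_of_ne (ne_of_gt hx.2))
  set v := u + ((fun z => x₁ k ^ (b - 1) * z k ^ (1 - b)) + fun z => g (‖z - x₀‖ ^ 2)) with hv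
  have hv2 : ∀ x ∈ ball x₀ (7 * r) ∩ {x | 0 < x k}, ContDiffAt ℝ 2 v x := fun x hx =>
    (hu2' x hx).add ((hp2 x hx).add (hg2' x))
  set κ := κ₀ / r ^ 2
  set c := (C₂ / l) ^ Fintype.card ι with hc
  set S := {x ∈ closedBall x₀ r | 0 < x k ∧ u x ≤ A ∧ (x₀ k + r) / (4 * C₂) ≤ x k ∧
    |(contactMatrix κ v x).det| ≤ c} with hS
  have hSU : S ⊆ ball x₀ (7 * r) ∩ {x | 0 < x k} := fun x hx =>
    ⟨closedBall_subset_ball (by linarith) hx.1, hx.2.1⟩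
  have hSm : MeasurableSet S := by
    have h1 := measurableSet_sep_le_of_continuousOn hUo hu2.continuousOn A
    have h2 := measurableSet_sep_le_of_continuousOn hUo
      (continuousOn_det_contactMatrix (κ := κ) hv2).abs c
    have h3 : MeasurableSet {x : EuclideanSpace ℝ ι | (x₀ k + r) / (4 * C₂) ≤ x k} :=
      (isClosed_le continuous_const
        (EuclideanSpace.proj k : EuclideanSpace ℝ ι →L[ℝ] ℝ).continuous).measurableSet
    convert (isClosed_closedBall (x := x₀) (ε := r)).measurableSet.inter ((h1.inter h2).inter h3)
      using 1
    ext x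
    constructor
    · intro hx
      have := hSU hx
      exact ⟨hx.1, ⟨⟨this, hx.2.2.1⟩, ⟨this, hx.2.2.2.2⟩⟩, hx.2.2.2.1⟩
    · rintro ⟨h1, ⟨⟨h2, h3⟩, ⟨-, h4⟩⟩, h5⟩
      exact ⟨h1, h2.2, h3, h5, h4⟩
  have himage : closedBall (x₀ + EuclideanSpace.single k (r / 2)) (r / 4) ⊆
      vertexMap κ v '' S := by
    intro y hy
    obtain ⟨hyr, hyk⟩ := mem_shiftedBall hr hx₀ hy
    obtain ⟨x, h1, h2, h3, h4, h5, h6⟩ := exists_contact_point hl hb hb' hκ₀ hκ₀' hD hr hC₀ hC₂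
      hg hg' hpos hneg hin hout hlow (by linarith) hsup hsup' hx₀ hu0 hsol hu2' hg2' hp2 hx₁ hx₁k
      hux₁ hv hyr hyk
    exact ⟨x, ⟨h1, h2, h3, h4, h5⟩, h6⟩
  calc volume (closedBall (x₀ + EuclideanSpace.single k (r / 2)) (r / 4))
      ≤ volume (vertexMap κ v '' S) := measure_mono himage
    _ ≤ ∫⁻ x in S, ENNReal.ofReal |(fderiv ℝ (vertexMap κ v) x).det| :=
        addHaar_image_le_lintegral_abs_det_fderiv volume hSm fun x hx =>
          (hasFDerivAt_vertexMap (hv2 x (hSU hx))).1.hasFDerivWithinAt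
    _ ≤ ∫⁻ _ in S, ENNReal.ofReal c := setLIntegral_mono measurable_const fun x hx => by
        rw [(hasFDerivAt_vertexMap (hv2 x (hSU hx))).2]
        exact ENNReal.ofReal_le_ofReal hx.2.2.2.2
    _ = ENNReal.ofReal c * volume S := by simp
    _ ≤ _ := by
        gcongr ENNReal.ofReal ?_ * volume ?_
        · exact le_max_right _ _
        · rintro x ⟨h1, h2, h3, h4, -⟩
          refine ⟨h1, h2, h3, le_trans ?_ h4⟩
          gcongr
          exact le_max_left _ _

end Measure

section Weight

variable {ι : Type*} [Fintype ι]

/-- The measure `(x_k)₊ ^ b dx`. -/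
def weightedMeasure (k : ι) (b : ℝ) : Measure (EuclideanSpace ℝ ι) :=
  volume.withDensity fun x => ENNReal.ofReal (max (x k) 0 ^ b)

theorem measurable_weight (k : ι) (b : ℝ) :
    Measurable fun x : EuclideanSpace ℝ ι => ENNReal.ofReal (max (x k) 0 ^ b) := by
  have : Measurable fun x : EuclideanSpace ℝ ι => x k :=
    (EuclideanSpace.proj k : EuclideanSpace ℝ ι →L[ℝ] ℝ).continuous.measurable
  exact ((this.max measurable_const).pow_const b).ennreal_ofReal

theorem weightedMeasure_le {k : ι} {b t : ℝ} (hb : 0 ≤ b) (ht : 0 ≤ t)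
    {s : Set (EuclideanSpace ℝ ι)} (hs : ∀ x ∈ s, x k ≤ t) :
    weightedMeasure k b s ≤ ENNReal.ofReal (t ^ b) * volume s := by
  rw [weightedMeasure, withDensity_apply', ← setLIntegral_const]
  refine setLIntegral_mono measurable_const fun x hx => ?_
  gcongr
  exact max_le (hs x hx) ht

theorem le_weightedMeasure {k : ι} {b t : ℝ} (hb : 0 ≤ b) (ht : 0 ≤ t)
    {s : Set (EuclideanSpace ℝ ι)} (hs : ∀ x ∈ s, t ≤ x k) :
    ENNReal.ofReal (t ^ b) * volume s ≤ weightedMeasure k b s := by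
  rw [weightedMeasure, withDensity_apply', ← setLIntegral_const]
  refine setLIntegral_mono (measurable_weight k b) fun x hx => ?_
  gcongr
  exact le_max_of_le_left (hs x hx)

theorem weightedMeasure_nonpos {k : ι} {b : ℝ} (hb : 0 < b) :
    weightedMeasure k b {x | x k ≤ 0} = 0 := by
  have := weightedMeasure_le (k := k) hb.le le_rfl (s := {x | x k ≤ 0}) fun x hx => hx
  simpa [Real.zero_rpow hb.ne'] using this

theorem volume_closedBall_smul (x y : EuclideanSpace ℝ ι) {t r : ℝ} (ht : 0 ≤ t) (hr : 0 ≤ r) :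
    volume (closedBall x (t * r)) =
      ENNReal.ofReal (t ^ Fintype.card ι) * volume (closedBall y r) := by
  rw [Measure.addHaar_closedBall _ _ (mul_nonneg ht hr), Measure.addHaar_closedBall _ y hr,
    mul_pow, ENNReal.ofReal_mul (by positivity), finrank_euclideanSpace, mul_assoc]

theorem weightedMeasure_closedBall_lt_top {k : ι} {b : ℝ} (hb : 0 ≤ b) (x : EuclideanSpace ℝ ι)
    (r : ℝ) : weightedMeasure k b (closedBall x r) < ⊤ := by
  refine (weightedMeasure_le (t := max (x k + r) 0) hb (le_max_right _ _) fun y hy =>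
    le_max_of_le_left (apply_le_of_mem_closedBall hy).2).trans_lt ?_
  exact ENNReal.mul_lt_top ENNReal.ofReal_lt_top measure_closedBall_lt_top

variable [DecidableEq ι]

theorem volume_shiftedBall_le {k : ι} {b r : ℝ} (hb : 0 ≤ b) (hr : 0 < r)
    {x : EuclideanSpace ℝ ι} (hx : 0 < x k) :
    ENNReal.ofReal (((x k + r) / 4) ^ b) *
      volume (closedBall (x + EuclideanSpace.single k (r / 2)) (r / 4)) ≤
      weightedMeasure k b (closedBall x r) :=
  (le_weightedMeasure hb (by positivity) fun _ hy => (mem_shiftedBall hr hx hy).2).trans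
    (measure_mono fun _ hy => (mem_shiftedBall hr hx hy).1)

theorem weightedMeasure_closedBall_le {k : ι} {b b₁ r τ : ℝ} (hb : 0 ≤ b) (hb' : b ≤ b₁)
    (hr : 0 < r) (hτ : 1 ≤ τ) {x : EuclideanSpace ℝ ι} (hx : 0 < x k) :
    weightedMeasure k b (closedBall x (τ * r)) ≤
      ENNReal.ofReal ((4 * τ) ^ b₁ * (4 * τ) ^ Fintype.card ι) *
        weightedMeasure k b (closedBall x r) := by
  have hτ0 : 0 < τ := by linarith
  calc weightedMeasure k b (closedBall x (τ * r))
      ≤ ENNReal.ofReal ((x k + τ * r) ^ b) * volume (closedBall x (τ * r)) :=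
        weightedMeasure_le hb (by positivity) fun y hy => (apply_le_of_mem_closedBall hy).2
    _ = ENNReal.ofReal ((x k + τ * r) ^ b) * (ENNReal.ofReal ((4 * τ) ^ Fintype.card ι) *
        volume (closedBall (x + EuclideanSpace.single k (r / 2)) (r / 4))) := by
        rw [← volume_closedBall_smul x _ (by positivity) (by positivity)]
        congr 3
        ring
    _ ≤ ENNReal.ofReal ((4 * τ) ^ b₁ * ((x k + r) / 4) ^ b) *
        (ENNReal.ofReal ((4 * τ) ^ Fintype.card ι) *
        volume (closedBall (x + EuclideanSpace.single k (r / 2)) (r / 4))) := by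
        gcongr
        calc (x k + τ * r) ^ b ≤ ((4 * τ) * ((x k + r) / 4)) ^ b := by
              gcongr
              nlinarith
          _ = (4 * τ) ^ b * ((x k + r) / 4) ^ b := Real.mul_rpow (by positivity) (by positivity)
          _ ≤ _ := by
              gcongr
              linarith
    _ = ENNReal.ofReal ((4 * τ) ^ b₁ * (4 * τ) ^ Fintype.card ι) *
        (ENNReal.ofReal (((x k + r) / 4) ^ b) *
        volume (closedBall (x + EuclideanSpace.single k (r / 2)) (r / 4))) := by
        rw [ENNReal.ofReal_mul (by positivity), ENNReal.ofReal_mul (by positivity)]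
        ring
    _ ≤ _ := by
        gcongr
        exact volume_shiftedBall_le hb hr hx

theorem weightedMeasure_closedBall_pos {k : ι} {b r : ℝ} (hb : 0 ≤ b) (hr : 0 < r)
    {x : EuclideanSpace ℝ ι} (hx : 0 < x k) : 0 < weightedMeasure k b (closedBall x r) := by
  refine lt_of_lt_of_le (ENNReal.mul_pos ?_ ?_) (volume_shiftedBall_le hb hr hx)
  · have : 0 < ((x k + r) / 4) ^ b := Real.rpow_pos_of_pos (by positivity) _
    simpa using this
  · exact (measure_closedBall_pos _ _ (by positivity)).ne'

end Weight

section Growth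

variable {ι : Type*} [Fintype ι] [DecidableEq ι]

theorem degOp_affine (k : ι) (A : ι → ι → ℝ) (b c m : ℝ) (u : EuclideanSpace ℝ ι → ℝ)
    (x : EuclideanSpace ℝ ι) :
    degOp k A b (fun y => c * (u y - m)) x = c * degOp k A b u x := by
  have h1 : fderiv ℝ (fun y => c * (u y - m)) = c • fderiv ℝ u := by
    funext y
    have : (fun y => c * (u y - m)) = c • fun y => u y - m := rfl
    rw [this, fderiv_const_smul_field]
    simp [fderiv_sub_const]
  have h2 : fderiv ℝ (c • fderiv ℝ u) = c • fderiv ℝ (fderiv ℝ u) :=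
    fderiv_const_smul_field (f := fderiv ℝ u) c
  unfold degOp
  rw [h1, h2]
  simp only [Pi.smul_apply, FunLike.coe_smul, smul_eq_mul, mul_add, Finset.mul_sum]
  congr 1
  · refine Finset.sum_congr rfl fun i _ => Finset.sum_congr rfl fun j _ => by ring
  · ring

/-- Nonnegative `C²` supersolutions on `W ∩ {x_k > 0}`. -/
structure IsNonnegSupersolutionOn (k : ι) (l L b : ℝ) (u : EuclideanSpace ℝ ι → ℝ)
    (W : Set (EuclideanSpace ℝ ι)) : Prop where
  contDiffOn : ContDiffOn ℝ 2 u (W ∩ {x | 0 < x k})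
  nonneg : ∀ x ∈ W ∩ {x | 0 < x k}, 0 ≤ u x
  isSupersolutionAt : ∀ x ∈ W ∩ {x | 0 < x k}, IsSupersolutionAt k l L b u x

theorem IsNonnegSupersolutionOn.mono {k : ι} {l L b : ℝ} {u : EuclideanSpace ℝ ι → ℝ}
    {V W : Set (EuclideanSpace ℝ ι)} (h : IsNonnegSupersolutionOn k l L b u W) (hV : V ⊆ W) :
    IsNonnegSupersolutionOn k l L b u V where
  contDiffOn := h.contDiffOn.mono (inter_subset_inter_left _ hV)
  nonneg x hx := h.nonneg x ⟨hV hx.1, hx.2⟩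
  isSupersolutionAt x hx := h.isSupersolutionAt x ⟨hV hx.1, hx.2⟩

theorem IsNonnegSupersolutionOn.const_mul {k : ι} {l L b c : ℝ} {u : EuclideanSpace ℝ ι → ℝ}
    {W : Set (EuclideanSpace ℝ ι)} (h : IsNonnegSupersolutionOn k l L b u W) (hc : 0 ≤ c) :
    IsNonnegSupersolutionOn k l L b (fun x => c * u x) W where
  contDiffOn := contDiffOn_const.mul h.contDiffOn
  nonneg x hx := mul_nonneg hc (h.nonneg x hx)
  isSupersolutionAt x hx := by
    obtain ⟨A, hA, hAk, hle⟩ := h.isSupersolutionAt x hx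
    have h1 := degOp_affine k A b c 0 u x
    simp only [sub_zero] at h1
    exact ⟨A, hA, hAk, h1 ▸ mul_nonpos_of_nonneg_of_nonpos hc hle⟩

/-- If `u ≤ t` holds only on a small fraction of a ball, then `u > t / A` on a larger ball. -/
def GrowthProperty (k : ι) (l L b₁ A C : ℝ) : Prop :=
  ∀ (b : ℝ) (u : EuclideanSpace ℝ ι → ℝ) (x₀ : EuclideanSpace ℝ ι) (r t : ℝ),
    1 < b → b ≤ b₁ → 0 < r → 0 < x₀ k → 0 < t →
    IsNonnegSupersolutionOn k l L b u (ball x₀ (7 * r)) →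
    ENNReal.ofReal C * weightedMeasure k b {x ∈ closedBall x₀ r | 0 < x k ∧ u x ≤ t} <
      weightedMeasure k b (closedBall x₀ r) →
    ∀ x ∈ closedBall x₀ (4 * r), 0 < x k → t / A < u x

theorem exists_growthProperty (k : ι) {l L b₁ : ℝ} (hl : 0 < l) (hL : 0 < L) (hb₁ : 1 < b₁) :
    ∃ A C : ℝ, 1 < A ∧ 1 ≤ C ∧ GrowthProperty k l L b₁ A C := by
  obtain ⟨A, C, hA, hC, h⟩ := exists_contact_constants k hl hL hb₁
  have hC0 : 0 < C := by linarith
  refine ⟨A, C ^ b₁ * 4 ^ Fintype.card ι * C, hA, ?_, ?_⟩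
  · have h1 : 1 ≤ C ^ b₁ := Real.one_le_rpow hC (by linarith)
    have h2 : (1 : ℝ) ≤ 4 ^ Fintype.card ι := one_le_pow₀ (by norm_num)
    exact one_le_mul_of_one_le_of_one_le (one_le_mul_of_one_le_of_one_le h1 h2) hC
  intro b u x₀ r t hb hb' hr hx₀ ht hu
  contrapose!
  rintro ⟨x₁, hx₁, hx₁k, hux₁⟩
  have hA0 : 0 < A := by linarith
  have hu' := hu.const_mul (c := A / t) (by positivity)
  have hvol := h b _ x₀ x₁ r hb hb' hr hx₀ hu'.contDiffOn hu'.nonneg hu'.isSupersolutionAt hx₁ hx₁k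
    (by
      calc A / t * u x₁ ≤ A / t * (t / A) := by gcongr
        _ = 1 := by field_simp)
  set S := {x ∈ closedBall x₀ r | 0 < x k ∧ A / t * u x ≤ A ∧ (x₀ k + r) / C ≤ x k} with hS
  have hST : S ⊆ {x ∈ closedBall x₀ r | 0 < x k ∧ u x ≤ t} := by
    rintro x ⟨h1, h2, h3, -⟩
    refine ⟨h1, h2, ?_⟩
    rw [div_mul_eq_mul_div, div_le_iff₀ ht] at h3
    exact le_of_mul_le_mul_left h3 hA0
  have hb0 : 0 ≤ b := by linarith
  calc weightedMeasure k b (closedBall x₀ r)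
      ≤ ENNReal.ofReal ((x₀ k + r) ^ b) * volume (closedBall x₀ r) :=
        weightedMeasure_le hb0 (by positivity) fun y hy => (apply_le_of_mem_closedBall hy).2
    _ = ENNReal.ofReal ((x₀ k + r) ^ b) * (ENNReal.ofReal (4 ^ Fintype.card ι) *
        volume (closedBall (x₀ + EuclideanSpace.single k (r / 2)) (r / 4))) := by
        rw [← volume_closedBall_smul x₀ _ (by positivity) (by positivity)]
        congr 3
        ring
    _ ≤ ENNReal.ofReal (C ^ b₁ * ((x₀ k + r) / C) ^ b) * (ENNReal.ofReal (4 ^ Fintype.card ι) *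
        (ENNReal.ofReal C * volume S)) := by
        gcongr
        calc (x₀ k + r) ^ b = (C * ((x₀ k + r) / C)) ^ b := by congr 1; field_simp
          _ = C ^ b * ((x₀ k + r) / C) ^ b := Real.mul_rpow (by positivity) (by positivity)
          _ ≤ _ := by gcongr
    _ = ENNReal.ofReal (C ^ b₁ * 4 ^ Fintype.card ι * C) *
        (ENNReal.ofReal (((x₀ k + r) / C) ^ b) * volume S) := by
        rw [ENNReal.ofReal_mul (by positivity), ENNReal.ofReal_mul (by positivity),
          ENNReal.ofReal_mul (by positivity)]
        ring
    _ ≤ _ := by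
        gcongr
        exact (le_weightedMeasure hb0 (by positivity) fun x hx => hx.2.2.2).trans
          (measure_mono hST)

end Growth

section Covering

theorem measure_le_of_forall_closedBall {X : Type*} [PseudoMetricSpace X]
    [TopologicalSpace.SeparableSpace X] [MeasurableSpace X] [OpensMeasurableSpace X]
    (μ : Measure X) {S G : Set X} (hG : MeasurableSet G) {C : ENNReal} {R : ℝ}
    (h : ∀ x ∈ S, ∃ r, 0 < r ∧ r ≤ R ∧ μ (closedBall x (5 * r)) ≤ C * μ (closedBall x r ∩ G)) :
    μ S ≤ C * μ G := by
  choose! r hr using h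
  obtain ⟨u, huS, hdisj, hcov⟩ := Vitali.exists_disjoint_subfamily_covering_enlargement_closedBall
    S id r R (fun x hx => (hr x hx).2.1) 5 (by norm_num)
  have hu : u.Countable := hdisj.countable_of_nonempty_interior fun x hx =>
    ⟨x, ball_subset_interior_closedBall (mem_ball_self (hr x (huS hx)).1)⟩
  have hS : S ⊆ ⋃ x ∈ u, closedBall x (5 * r x) := fun x hx => by
    obtain ⟨y, hy, hxy⟩ := hcov x hx
    exact mem_biUnion hy (hxy (mem_closedBall_self (hr x hx).1.le))
  calc μ S ≤ ∑' x : u, μ (closedBall x (5 * r x)) :=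
        (measure_mono hS).trans (measure_biUnion_le μ hu _)
    _ ≤ ∑' x : u, C * μ (closedBall x (r x) ∩ G) :=
        ENNReal.tsum_le_tsum fun x => (hr x (huS x.2)).2.2
    _ = C * ∑' x : u, μ (closedBall x (r x) ∩ G) := ENNReal.tsum_mul_left
    _ = C * μ (⋃ x ∈ u, closedBall x (r x) ∩ G) := by
        have hd : u.PairwiseDisjoint fun x => closedBall x (r x) ∩ G :=
          hdisj.mono fun x => inter_subset_left
        rw [measure_biUnion hu hd fun x _ => isClosed_closedBall.measurableSet.inter hG]
    _ ≤ C * μ G := by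
        gcongr
        exact iUnion₂_subset fun _ _ => inter_subset_right

end Covering

section Growth

variable {ι : Type*} [Fintype ι] [DecidableEq ι]

theorem GrowthProperty.iterate {k : ι} {l L b₁ A C : ℝ} (hG : GrowthProperty k l L b₁ A C)
    (hA : 1 < A) {b : ℝ} {u : EuclideanSpace ℝ ι → ℝ} {z : EuclideanSpace ℝ ι} {s t : ℝ}
    (hb : 1 < b) (hb' : b ≤ b₁) (hs : 0 < s) (hz : 0 < z k) (ht : 0 < t) (i : ℕ)
    (hu : IsNonnegSupersolutionOn k l L b u (ball z (7 * (4 ^ i * s))))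
    (hd : ENNReal.ofReal C * weightedMeasure k b {x ∈ closedBall z s | 0 < x k ∧ u x ≤ t} <
      weightedMeasure k b (closedBall z s)) :
    ∀ x ∈ closedBall z (4 ^ (i + 1) * s), 0 < x k → t / A ^ (i + 1) < u x := by
  induction i with
  | zero => simpa using hG b u z s t hb hb' hs hz ht (by simpa using hu) hd
  | succ i ih =>
    have ih := ih (hu.mono (ball_subset_ball (by gcongr <;> norm_num)))
    have h := hG b u z (4 ^ (i + 1) * s) (t / A ^ (i + 1)) hb hb' (by positivity) hz
      (by positivity) hu ?_
    · intro x hx hxk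
      have := h x (by rwa [← mul_assoc, ← pow_succ']) hxk
      rwa [div_div, ← pow_succ] at this
    · have : {x ∈ closedBall z (4 ^ (i + 1) * s) | 0 < x k ∧ u x ≤ t / A ^ (i + 1)} = ∅ := by
        refine eq_empty_of_forall_notMem fun x hx => ?_
        exact absurd (ih x hx.1 hx.2.1) (not_lt.mpr hx.2.2)
      rw [this]
      simpa using weightedMeasure_closedBall_pos (by linarith) (by positivity) hz

theorem IsNonnegSupersolutionOn.isOpen_superlevel {k : ι} {l L b : ℝ}
    {u : EuclideanSpace ℝ ι → ℝ} {W : Set (EuclideanSpace ℝ ι)} (hW : IsOpen W)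
    (hu : IsNonnegSupersolutionOn k l L b u W) (t : ℝ) :
    IsOpen (W ∩ {x : EuclideanSpace ℝ ι | 0 < x k} ∩ u ⁻¹' Ioi t) :=
  hu.contDiffOn.continuousOn.isOpen_inter_preimage (hW.inter (isOpen_pos_coord k)) isOpen_Ioi

theorem IsNonnegSupersolutionOn.measurableSet_superlevel {k : ι} {l L b : ℝ}
    {u : EuclideanSpace ℝ ι → ℝ} {W : Set (EuclideanSpace ℝ ι)} (hW : IsOpen W)
    (hu : IsNonnegSupersolutionOn k l L b u W) (t : ℝ) {x₀ : EuclideanSpace ℝ ι} {σ : ℝ}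
    (hσ : closedBall x₀ σ ⊆ W) : MeasurableSet {x ∈ closedBall x₀ σ | 0 < x k ∧ t < u x} := by
  convert (isClosed_closedBall (x := x₀) (ε := σ)).measurableSet.inter
    (hu.isOpen_superlevel hW t).measurableSet using 1
  ext x
  exact ⟨fun h => ⟨h.1, ⟨hσ h.1, h.2.1⟩, h.2.2⟩, fun h => ⟨h.1, h.2.1.2, h.2.2⟩⟩

theorem GrowthProperty.measure_superlevel_le {k : ι} {l L b₁ A C : ℝ}
    (hG : GrowthProperty k l L b₁ A C)
    {b : ℝ} {u : EuclideanSpace ℝ ι → ℝ} {x₀ : EuclideanSpace ℝ ι} {ρ r t : ℝ}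
    (hb : 1 < b) (hb' : b ≤ b₁) (hr : 0 < r) (ht : 0 < t)
    (hu : IsNonnegSupersolutionOn k l L b u (ball x₀ (ρ + 7 * r)))
    (hN : ∀ z ∈ closedBall x₀ ρ, 0 < z k → weightedMeasure k b (closedBall z r) ≤
      ENNReal.ofReal C * weightedMeasure k b {x ∈ closedBall z r | 0 < x k ∧ u x ≤ t}) :
    weightedMeasure k b {x ∈ closedBall x₀ ρ | 0 < x k ∧ t < u x} ≤
      ENNReal.ofReal ((4 * 5) ^ b₁ * (4 * 5) ^ Fintype.card ι) * ENNReal.ofReal C *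
        weightedMeasure k b ({x ∈ closedBall x₀ (ρ + r) | 0 < x k ∧ t / A < u x} \
          {x ∈ closedBall x₀ ρ | 0 < x k ∧ t < u x}) := by
  have hmeas : ∀ σ s, σ < ρ + 7 * r →
      MeasurableSet {x ∈ closedBall x₀ σ | 0 < x k ∧ s < u x} := fun σ s hσ =>
    hu.measurableSet_superlevel isOpen_ball s (closedBall_subset_ball hσ)
  refine measure_le_of_forall_closedBall _
    ((hmeas _ _ (by linarith)).diff (hmeas _ _ (by linarith))) (R := r) ?_
  rintro x ⟨hx, hxk, hux⟩
  have hex : ∃ j : ℕ, ENNReal.ofReal C * weightedMeasure k b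
      {y ∈ closedBall x (r / 2 ^ j) | 0 < y k ∧ u y ≤ t} <
      weightedMeasure k b (closedBall x (r / 2 ^ j)) := by
    obtain ⟨ε, hε, hεU⟩ := Metric.isOpen_iff.mp (hu.isOpen_superlevel isOpen_ball t) x
      ⟨⟨closedBall_subset_ball (by linarith) hx, hxk⟩, hux⟩
    obtain ⟨j, hj⟩ := exists_pow_lt_of_lt_one (div_pos hε hr) (show (1 / 2 : ℝ) < 1 by norm_num)
    refine ⟨j, ?_⟩
    have hj' : r / 2 ^ j < ε := by
      rw [lt_div_iff₀ hr] at hj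
      calc r / 2 ^ j = (1 / 2) ^ j * r := by rw [one_div, inv_pow]; ring
        _ < ε := hj
    have : {y ∈ closedBall x (r / 2 ^ j) | 0 < y k ∧ u y ≤ t} = ∅ := by
      refine eq_empty_of_forall_notMem fun y hy => ?_
      exact absurd (hεU (closedBall_subset_ball hj' hy.1)).2 (not_lt.mpr hy.2.2)
    rw [this]
    simpa using weightedMeasure_closedBall_pos (by linarith) (by positivity) hxk
  classical
  obtain ⟨j, hj, hmin⟩ : ∃ j : ℕ, ENNReal.ofReal C * weightedMeasure k b
      {y ∈ closedBall x (r / 2 ^ j) | 0 < y k ∧ u y ≤ t} <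
      weightedMeasure k b (closedBall x (r / 2 ^ j)) ∧ ∀ i < j,
      ¬ ENNReal.ofReal C * weightedMeasure k b
      {y ∈ closedBall x (r / 2 ^ i) | 0 < y k ∧ u y ≤ t} <
      weightedMeasure k b (closedBall x (r / 2 ^ i)) :=
    ⟨Nat.find hex, Nat.find_spec hex, fun i => Nat.find_min hex⟩
  obtain _ | j := j
  · exact absurd hj (not_lt.mpr (by simpa using hN x hx hxk))
  have hnot := not_lt.mp (hmin j (Nat.lt_succ_self j))
  have hle : r / 2 ^ j ≤ r := div_le_self hr.le (one_le_pow₀ (by norm_num))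
  have hle' : r / 2 ^ (j + 1) ≤ r := div_le_self hr.le (one_le_pow₀ (by norm_num))
  have hgrow := hG b u x _ t hb hb' (by positivity) hxk ht (hu.mono fun y hy => ?_) hj
  swap
  · rw [mem_ball] at hy ⊢
    rw [mem_closedBall] at hx
    linarith [dist_triangle y x x₀]
  refine ⟨r / 2 ^ j, by positivity, hle, ?_⟩
  refine (weightedMeasure_closedBall_le (by linarith) hb' (by positivity) (by norm_num)
    hxk).trans ?_
  rw [mul_assoc]
  gcongr
  refine hnot.trans ?_
  gcongr
  rintro y ⟨hy, hyk, huy⟩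
  refine ⟨hy, ⟨?_, hyk, hgrow y (closedBall_subset_closedBall ?_ hy) hyk⟩,
    fun h => absurd h.2.2 (not_lt.mpr huy)⟩
  · rw [mem_closedBall] at *
    linarith [dist_triangle y x x₀]
  · rw [pow_succ, ← div_div]
    have : 0 < r / 2 ^ j := by positivity
    linarith

theorem exists_lower_bound_constants (k : ι) {l L b₁ : ℝ} (hl : 0 < l) (hL : 0 < L)
    (hb₁ : 1 < b₁) :
    ∃ R c : ℝ, 2 < R ∧ 0 < c ∧ c < 1 ∧ ∀ (b : ℝ) (u : EuclideanSpace ℝ ι → ℝ)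
      (x₀ : EuclideanSpace ℝ ι) (r : ℝ), 1 < b → b ≤ b₁ → 0 < r → 0 < x₀ k →
      IsNonnegSupersolutionOn k l L b u (ball x₀ (R * r)) →
      weightedMeasure k b (closedBall x₀ r) ≤
        2 * weightedMeasure k b {x ∈ closedBall x₀ r | 0 < x k ∧ 1 ≤ u x} →
      ∀ x ∈ closedBall x₀ r, 0 < x k → c ≤ u x := by
  obtain ⟨A, C, hA, hC, hG⟩ := exists_growthProperty k hl hL hb₁
  have hA0 : 0 < A := by linarith
  have hC0 : 0 < C := by linarith
  set M : ℝ := (4 * 5) ^ b₁ * (4 * 5) ^ Fintype.card ι * C with hM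
  have hM0 : 0 < M := by positivity
  set D : ℝ := (4 * 2) ^ b₁ * (4 * 2) ^ Fintype.card ι with hD
  have hD0 : 0 < D := by positivity
  clear_value M D
  obtain ⟨K, hK⟩ := pow_unbounded_of_one_lt (D * 2) (show 1 < (1 + M) / M by
    rw [lt_div_iff₀ hM0]; linarith)
  rw [div_pow, lt_div_iff₀ (by positivity)] at hK
  set I := 3 * (K + 1) with hI
  refine ⟨2 + 7 * 4 ^ I, 1 / 2 / A ^ K / A ^ (I + 1), ?_, by positivity, ?_, ?_⟩
  · have : (0 : ℝ) < 4 ^ I := by positivity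
    linarith
  · rw [div_div, ← pow_add]
    refine (div_le_self (by norm_num) (one_le_pow₀ hA.le)).trans_lt (by norm_num)
  intro b u x₀ r hb hb' hr hx₀ hu hhalf
  have hK0 : (0 : ℝ) < K + 1 := by positivity
  set r₀ := r / (K + 1) with hr₀
  have hr₀pos : 0 < r₀ := by positivity
  have hr₀le : r₀ ≤ r := div_le_self hr.le (by linarith [(Nat.cast_nonneg K : (0 : ℝ) ≤ K)])
  have h4I : (1 : ℝ) ≤ 4 ^ I := one_le_pow₀ (by norm_num)
  have h4r : r ≤ 4 ^ I * r := le_mul_of_one_le_left hr.le h4I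
  by_cases hdense : ∃ j < K, ∃ z ∈ closedBall x₀ (2 * r), 0 < z k ∧
      ENNReal.ofReal C * weightedMeasure k b
        {x ∈ closedBall z r₀ | 0 < x k ∧ u x ≤ 1 / 2 / A ^ j} <
      weightedMeasure k b (closedBall z r₀)
  · obtain ⟨j, hj, z, hz, hzk, hd⟩ := hdense
    intro x hx hxk
    rw [mem_closedBall] at hx hz
    have h := hG.iterate hA hb hb' hr₀pos hzk (t := 1 / 2 / A ^ j) (by positivity) I
      (hu.mono fun y hy => ?_) hd x ?_ hxk
    · refine le_trans ?_ h.le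
      gcongr
      exact hA.le
    · rw [mem_ball] at hy ⊢
      have : 7 * (4 ^ I * r₀) ≤ 7 * 4 ^ I * r := by
        rw [mul_assoc]; gcongr
      linarith [dist_triangle y z x₀]
    · rw [mem_closedBall]
      have h1 : (3 * (K + 1) : ℝ) ≤ 4 ^ (I + 1) := by
        have : I < 4 ^ I := Nat.lt_pow_self (by norm_num)
        have h2 : ((3 * (K + 1) : ℕ) : ℝ) ≤ ((4 ^ I : ℕ) : ℝ) := by exact_mod_cast this.le
        push_cast at h2
        rw [pow_succ]
        linarith
      have h2 : 3 * (K + 1) * r₀ = 3 * r := by rw [hr₀]; field_simp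
      have h3 : 3 * (K + 1) * r₀ ≤ 4 ^ (I + 1) * r₀ := by gcongr
      linarith [dist_triangle_right x z x₀]
  · exfalso
    push Not at hdense
    set E : ℕ → Set (EuclideanSpace ℝ ι) := fun j =>
      {x ∈ closedBall x₀ (r + j * r₀) | 0 < x k ∧ 1 / 2 / A ^ j < u x} with hE
    set μ := weightedMeasure k b with hμ
    have hrad : ∀ j : ℕ, j ≤ K → r + j * r₀ ≤ 2 * r := fun j hj => by
      have h1 : (j : ℝ) * r₀ ≤ (K + 1) * r₀ := by
        gcongr
        exact_mod_cast hj.trans (Nat.le_succ K)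
      have h2 : (K + 1) * r₀ = r := by rw [hr₀]; field_simp
      linarith
    have hstep : ∀ j < K, ENNReal.ofReal (1 + M) * μ (E j) ≤ ENNReal.ofReal M * μ (E (j + 1)) := by
      intro j hj
      have h := hG.measure_superlevel_le (t := 1 / 2 / A ^ j) (x₀ := x₀) (ρ := r + j * r₀) hb hb'
        hr₀pos (by positivity) (hu.mono (ball_subset_ball ?_)) fun z hz hzk =>
          hdense j hj z (closedBall_subset_closedBall (hrad j hj.le) hz) hzk
      · have hE1 : {x ∈ closedBall x₀ (r + j * r₀ + r₀) | 0 < x k ∧ 1 / 2 / A ^ j / A < u x} =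
            E (j + 1) := by
          simp only [hE, div_div]
          push_cast
          ring_nf
        rw [hE1, ← ENNReal.ofReal_mul (by positivity), ← hM] at h
        change μ (E j) ≤ ENNReal.ofReal M * μ (E (j + 1) \ E j) at h
        have hsub : E j ⊆ E (j + 1) := by
          rintro x ⟨h1, h2, h3⟩
          refine ⟨closedBall_subset_closedBall ?_ h1, h2, lt_of_le_of_lt ?_ h3⟩
          · push_cast; linarith
          · gcongr
            · exact hA.le
            · exact Nat.le_succ j
        rw [ENNReal.ofReal_add one_pos.le hM0.le, ENNReal.ofReal_one, add_mul, one_mul]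
        calc μ (E j) + ENNReal.ofReal M * μ (E j)
            ≤ ENNReal.ofReal M * μ (E (j + 1) \ E j) + ENNReal.ofReal M * μ (E j) := by gcongr
          _ = ENNReal.ofReal M * (μ (E (j + 1) \ E j) + μ (E j)) := by rw [mul_add]
          _ = ENNReal.ofReal M * μ (E (j + 1)) := by
              have hEm : MeasurableSet (E j) := hu.measurableSet_superlevel isOpen_ball _
                (closedBall_subset_ball (by linarith [hrad j hj.le]))
              rw [← measure_sdiff_add_inter (E (j + 1)) hEm, inter_eq_right.mpr hsub]
      · have := hrad j hj.le
        linarith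
    have hiter : ∀ j ≤ K, ENNReal.ofReal (1 + M) ^ j * μ (E 0) ≤
        ENNReal.ofReal M ^ j * μ (E j) := by
      intro j
      induction j with
      | zero => simp
      | succ j ih =>
        intro hj
        calc ENNReal.ofReal (1 + M) ^ (j + 1) * μ (E 0)
            = ENNReal.ofReal (1 + M) * (ENNReal.ofReal (1 + M) ^ j * μ (E 0)) := by ring
          _ ≤ ENNReal.ofReal (1 + M) * (ENNReal.ofReal M ^ j * μ (E j)) := by
              gcongr ENNReal.ofReal (1 + M) * ?_
              exact ih (by omega)
          _ = ENNReal.ofReal M ^ j * (ENNReal.ofReal (1 + M) * μ (E j)) := by ring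
          _ ≤ ENNReal.ofReal M ^ j * (ENNReal.ofReal M * μ (E (j + 1))) := by
              gcongr ENNReal.ofReal M ^ j * ?_
              exact hstep j hj
          _ = _ := by ring
    have hhalf' : μ (closedBall x₀ r) ≤ 2 * μ (E 0) := by
      refine hhalf.trans ?_
      gcongr
      rintro x ⟨h1, h2, h3⟩
      refine ⟨by simpa using h1, h2, ?_⟩
      norm_num
      linarith
    have hE0pos : μ (E 0) ≠ 0 := fun h => by
      rw [h, mul_zero] at hhalf'
      exact absurd hhalf' (not_le.mpr (weightedMeasure_closedBall_pos (by linarith) hr hx₀))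
    have hE0top : μ (E 0) ≠ ⊤ :=
      ((measure_mono fun x hx => hx.1).trans_lt
        (weightedMeasure_closedBall_lt_top (by linarith) _ _)).ne
    have hfin : ENNReal.ofReal ((1 + M) ^ K) * μ (E 0) ≤
        ENNReal.ofReal (D * 2 * M ^ K) * μ (E 0) := by
      calc ENNReal.ofReal ((1 + M) ^ K) * μ (E 0)
          = ENNReal.ofReal (1 + M) ^ K * μ (E 0) := by rw [ENNReal.ofReal_pow (by positivity)]
        _ ≤ ENNReal.ofReal M ^ K * μ (E K) := hiter K le_rfl
        _ ≤ ENNReal.ofReal M ^ K * (ENNReal.ofReal D * (2 * μ (E 0))) := by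
            gcongr
            refine (measure_mono fun x hx => closedBall_subset_closedBall (hrad K le_rfl)
              hx.1).trans ?_
            refine (weightedMeasure_closedBall_le (by linarith) hb' hr one_le_two hx₀).trans ?_
            rw [hD]
            gcongr
        _ = _ := by
            rw [ENNReal.ofReal_mul (by positivity), ENNReal.ofReal_mul (by positivity),
              ENNReal.ofReal_pow hM0.le, ENNReal.ofReal_ofNat]
            ring
    rw [ENNReal.mul_le_mul_iff_left hE0pos hE0top,
      ENNReal.ofReal_le_ofReal_iff (by positivity)] at hfin
    linarith

end Growth

section Oscillation

variable {ι : Type*} [Fintype ι] [DecidableEq ι]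

/-- `C²` solutions on `W ∩ {x_k > 0}` of `∑ A i j ∂ᵢⱼ w + b ∂ₖ w / xₖ = 0`, where `A` is elliptic
with `A k k = 1`. -/
structure IsSolutionOn (k : ι) (l L b : ℝ) (w : EuclideanSpace ℝ ι → ℝ)
    (W : Set (EuclideanSpace ℝ ι)) : Prop where
  contDiffOn : ContDiffOn ℝ 2 w (W ∩ {x | 0 < x k})
  exists_degOp_eq_zero : ∀ x ∈ W ∩ {x | 0 < x k},
    ∃ A : ι → ι → ℝ, IsElliptic l L A ∧ A k k = 1 ∧ degOp k A b w x = 0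

theorem IsSolutionOn.mono {k : ι} {l L b : ℝ} {w : EuclideanSpace ℝ ι → ℝ}
    {V W : Set (EuclideanSpace ℝ ι)} (h : IsSolutionOn k l L b w W) (hV : V ⊆ W) :
    IsSolutionOn k l L b w V where
  contDiffOn := h.contDiffOn.mono (inter_subset_inter_left _ hV)
  exists_degOp_eq_zero x hx := h.exists_degOp_eq_zero x ⟨hV hx.1, hx.2⟩

theorem IsSolutionOn.isNonnegSupersolutionOn {k : ι} {l L b c m : ℝ} {w : EuclideanSpace ℝ ι → ℝ}
    {W : Set (EuclideanSpace ℝ ι)} (h : IsSolutionOn k l L b w W)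
    (h0 : ∀ x ∈ W ∩ {x | 0 < x k}, 0 ≤ c * (w x - m)) :
    IsNonnegSupersolutionOn k l L b (fun x => c * (w x - m)) W where
  contDiffOn := contDiffOn_const.mul (h.contDiffOn.sub contDiffOn_const)
  nonneg := h0
  isSupersolutionAt x hx := by
    obtain ⟨A, hA, hAk, h1⟩ := h.exists_degOp_eq_zero x hx
    exact ⟨A, hA, hAk, by rw [degOp_affine, h1, mul_zero]⟩

theorem exists_oscillation_constants (k : ι) {l L b₁ : ℝ} (hl : 0 < l) (hL : 0 < L)
    (hb₁ : 1 < b₁) :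
    ∃ R θ : ℝ, 1 < R ∧ R⁻¹ < θ ∧ θ < 1 ∧ ∀ (b : ℝ) (w : EuclideanSpace ℝ ι → ℝ)
      (x₀ : EuclideanSpace ℝ ι) (r m ω : ℝ), 1 < b → b ≤ b₁ → 0 < r → 0 < x₀ k → 0 ≤ ω →
      IsSolutionOn k l L b w (ball x₀ (R * r)) →
      (∀ x ∈ ball x₀ (R * r), 0 < x k → w x ∈ Icc m (m + ω)) →
      ∃ m', ∀ x ∈ closedBall x₀ r, 0 < x k → w x ∈ Icc m' (m' + θ * ω) := by
  obtain ⟨R, c, hR, hc0, hc1, h⟩ := exists_lower_bound_constants k hl hL hb₁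
  refine ⟨R, 1 - c / 2, by linarith, ?_, by linarith, ?_⟩
  · have : R⁻¹ < 2⁻¹ := by gcongr
    norm_num at this
    linarith
  intro b w x₀ r m ω hb hb' hr hx₀ hω hw hosc
  obtain rfl | hω := hω.eq_or_lt
  · refine ⟨m, fun x hx hxk => ?_⟩
    have := hosc x (closedBall_subset_ball (by nlinarith) hx) hxk
    simpa using this
  have h1 := hw.isNonnegSupersolutionOn (c := 2 / ω) (m := m) fun x hx =>
    mul_nonneg (by positivity) (sub_nonneg.mpr (hosc x hx.1 hx.2).1)
  have h2 := hw.isNonnegSupersolutionOn (c := -(2 / ω)) (m := m + ω) fun x hx =>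
    mul_nonneg_of_nonpos_of_nonpos (neg_nonpos.mpr (by positivity))
      (sub_nonpos.mpr (hosc x hx.1 hx.2).2)
  set S₁ := {x ∈ closedBall x₀ r | 0 < x k ∧ 1 ≤ 2 / ω * (w x - m)} with hS₁
  set S₂ := {x ∈ closedBall x₀ r | 0 < x k ∧ 1 ≤ -(2 / ω) * (w x - (m + ω))} with hS₂
  have hcov : closedBall x₀ r ⊆ S₁ ∪ S₂ ∪ {x | x k ≤ 0} := fun x hx => by
    by_cases hxk : 0 < x k
    · have : 2 / ω * (w x - m) + -(2 / ω) * (w x - (m + ω)) = 2 := by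
        field_simp; ring
      obtain h | h := le_total 1 (2 / ω * (w x - m))
      · exact Or.inl (Or.inl ⟨hx, hxk, h⟩)
      · exact Or.inl (Or.inr ⟨hx, hxk, by linarith⟩)
    · exact Or.inr (not_lt.mp hxk)
  have hsum : weightedMeasure k b (closedBall x₀ r) ≤
      weightedMeasure k b S₁ + weightedMeasure k b S₂ := by
    refine (measure_mono hcov).trans ((measure_union_le _ _).trans ?_)
    rw [weightedMeasure_nonpos (by linarith), add_zero]
    exact measure_union_le _ _
  obtain hle | hle := le_total (weightedMeasure k b S₁) (weightedMeasure k b S₂)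
  · refine ⟨m, fun x hx hxk => ?_⟩
    have hlow := h b _ x₀ r hb hb' hr hx₀ h2 (hsum.trans ?_) x hx hxk
    · refine ⟨(hosc x (closedBall_subset_ball (by nlinarith) hx) hxk).1, ?_⟩
      have : c * (ω / 2) ≤ -(2 / ω) * (w x - (m + ω)) * (ω / 2) := by gcongr
      rw [show -(2 / ω) * (w x - (m + ω)) * (ω / 2) = m + ω - w x by field_simp; ring] at this
      linarith
    · rw [two_mul]; gcongr
  · refine ⟨m + c * (ω / 2), fun x hx hxk => ?_⟩
    have hlow := h b _ x₀ r hb hb' hr hx₀ h1 (hsum.trans ?_) x hx hxk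
    · have h3 := (hosc x (closedBall_subset_ball (by nlinarith) hx) hxk).2
      have : c * (ω / 2) ≤ 2 / ω * (w x - m) * (ω / 2) := by gcongr
      rw [show 2 / ω * (w x - m) * (ω / 2) = w x - m by field_simp] at this
      constructor <;> linarith
    · rw [two_mul]; gcongr

theorem exists_holder_constants (k : ι) {l L b₁ : ℝ} (hl : 0 < l) (hL : 0 < L) (hb₁ : 1 < b₁) :
    ∃ α C : ℝ, α ∈ Ioo (0 : ℝ) 1 ∧ 0 < C ∧ ∀ (b : ℝ) (w : EuclideanSpace ℝ ι → ℝ) (M : ℝ),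
      1 < b → b ≤ b₁ → IsSolutionOn k l L b w (ball 0 1) →
      (∀ x ∈ ball (0 : EuclideanSpace ℝ ι) 1, 0 < x k → |w x| ≤ M) →
      ∀ x y : EuclideanSpace ℝ ι, 0 < x k → 0 < y k → ‖x‖ ≤ 1 / 2 → ‖y‖ ≤ 1 / 2 →
        |w x - w y| ≤ C * M * ‖x - y‖ ^ α := by
  obtain ⟨R, θ, hR, hRθ, hθ1, hosc⟩ := exists_oscillation_constants k hl hL hb₁
  have hR0 : 0 < R := by linarith
  have hθ0 : 0 < θ := (inv_pos.mpr hR0).trans hRθ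
  have hlogR : 0 < Real.log R := Real.log_pos hR
  have hlogθ : Real.log θ < 0 := Real.log_neg hθ0 hθ1
  set α := -Real.log θ / Real.log R with hα
  have hα0 : 0 < α := div_pos (by linarith) hlogR
  have hα1 : α < 1 := by
    rw [hα, div_lt_one hlogR]
    have := Real.log_lt_log (inv_pos.mpr hR0) hRθ
    rw [Real.log_inv] at this
    linarith
  have hRα : R⁻¹ ^ α = θ := by
    rw [Real.inv_rpow hR0.le, ← Real.rpow_neg hR0.le, Real.rpow_def_of_pos hR0, hα]
    have : Real.log R * -(-Real.log θ / Real.log R) = Real.log θ := by field_simp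
    rw [this, Real.exp_log hθ0]
  refine ⟨α, 2 / θ * 4 ^ α, ⟨hα0, hα1⟩, by positivity, ?_⟩
  intro b w M hb hb' hw hwM x y hxk hyk hx hy
  have hx1 : x ∈ ball (0 : EuclideanSpace ℝ ι) 1 := by rw [mem_ball_zero_iff]; linarith
  have hy1 : y ∈ ball (0 : EuclideanSpace ℝ ι) 1 := by rw [mem_ball_zero_iff]; linarith
  have hMx := hwM x hx1 hxk
  have hMy := hwM y hy1 hyk
  have hM0 : 0 ≤ M := (abs_nonneg _).trans hMx
  have hsplit : 2 / θ * 4 ^ α * M * ‖x - y‖ ^ α = 2 * M / θ * (4 * ‖x - y‖) ^ α := by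
    rw [Real.mul_rpow (by norm_num) (norm_nonneg _)]; ring
  rw [hsplit]
  obtain hfar | hnear := lt_or_ge 1 (4 * ‖x - y‖)
  · calc |w x - w y| ≤ |w x| + |w y| := abs_sub _ _
      _ ≤ 2 * M := by linarith
      _ ≤ 2 * M / θ := le_div_self (by positivity) hθ0 hθ1.le
      _ ≤ _ := le_mul_of_one_le_right (by positivity) (Real.one_le_rpow hfar.le hα0.le)
  obtain hxy | hxy := (norm_nonneg (x - y)).eq_or_lt
  · rw [sub_eq_zero.mp (norm_eq_zero.mp hxy.symm), sub_self, abs_zero]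
    positivity
  have hball : closedBall x (1 / 4) ⊆ ball (0 : EuclideanSpace ℝ ι) 1 := fun z hz => by
    rw [mem_closedBall, dist_eq_norm] at hz
    rw [mem_ball_zero_iff]
    linarith [norm_le_norm_add_norm_sub' z x]
  have hiter : ∀ j : ℕ, ∃ m, ∀ z ∈ closedBall x (R⁻¹ ^ j * (1 / 4)), 0 < z k →
      w z ∈ Icc m (m + θ ^ j * (2 * M)) := by
    intro j
    induction j with
    | zero =>
      refine ⟨-M, fun z hz hzk => ?_⟩
      have := abs_le.mp (hwM z (hball (by simpa using hz)) hzk)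
      constructor <;> linarith
    | succ j ih =>
      obtain ⟨m, hm⟩ := ih
      have hrad : R * (R⁻¹ ^ (j + 1) * (1 / 4)) = R⁻¹ ^ j * (1 / 4) := by
        rw [pow_succ]; field_simp
      have hsub : R⁻¹ ^ j * (1 / 4) ≤ 1 / 4 :=
        mul_le_of_le_one_left (by norm_num)
          (pow_le_one₀ (inv_nonneg.mpr hR0.le) (inv_le_one_of_one_le₀ hR.le))
      obtain ⟨m', hm'⟩ := hosc b w x (R⁻¹ ^ (j + 1) * (1 / 4)) m (θ ^ j * (2 * M)) hb hb'
        (by positivity) hxk (by positivity)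
        (by
          rw [hrad]
          exact hw.mono (ball_subset_closedBall.trans ((closedBall_subset_closedBall hsub).trans
            hball)))
        (by
          rw [hrad]
          exact fun z hz hzk => hm z (ball_subset_closedBall hz) hzk)
      refine ⟨m', fun z hz hzk => ?_⟩
      rw [pow_succ', mul_assoc]
      exact hm' z hz hzk
  obtain ⟨j, hj1, hj2⟩ := exists_nat_pow_near_of_lt_one (by positivity) hnear
    (inv_pos.mpr hR0) (inv_lt_one_of_one_lt₀ hR)
  obtain ⟨m, hm⟩ := hiter j
  have h1 := hm x (mem_closedBall_self (by positivity)) hxk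
  have h2 := hm y (by rw [mem_closedBall, dist_eq_norm, norm_sub_rev]; linarith) hyk
  have h3 : |w x - w y| ≤ θ ^ j * (2 * M) := by
    rw [abs_sub_le_iff]
    constructor <;> linarith [h1.1, h1.2, h2.1, h2.2]
  have h4 : θ ^ (j + 1) ≤ (4 * ‖x - y‖) ^ α := by
    calc θ ^ (j + 1) = (R⁻¹ ^ (j + 1)) ^ α := by
          rw [← hRα, ← Real.rpow_natCast, ← Real.rpow_natCast, ← Real.rpow_mul (by positivity),
            ← Real.rpow_mul (by positivity), mul_comm]
      _ ≤ _ := by gcongr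
  calc |w x - w y| ≤ θ ^ j * (2 * M) := h3
    _ = 2 * M / θ * θ ^ (j + 1) := by rw [pow_succ]; field_simp
    _ ≤ _ := by gcongr

end Oscillation

section Main

theorem isElliptic_lastCases {m : ℕ} {lam Lam : ℝ} (a : Fin m → Fin m → ℝ)
    (ha : ∀ ξ : EuclideanSpace ℝ (Fin m), lam * ‖ξ‖ ^ 2 ≤ ∑ i, ∑ j, a i j * ξ i * ξ j ∧
      ∑ i, ∑ j, a i j * ξ i * ξ j ≤ Lam * ‖ξ‖ ^ 2) :
    IsElliptic (min lam 1) (max Lam 1) fun i j : Fin (m + 1) =>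
      Fin.lastCases (motive := fun _ => ℝ) (Fin.lastCases (motive := fun _ => ℝ) 1 (fun _ => 0) j)
        (fun i => Fin.lastCases (motive := fun _ => ℝ) 0 (fun j => a i j) j) i := by
  have key : ∀ ξ : Fin (m + 1) → ℝ, _ := fun ξ => ha (WithLp.toLp 2 fun i => ξ i.castSucc)
  simp only [EuclideanSpace.real_norm_sq_eq, mul_assoc] at key
  constructor
  · intro ξ
    simp only [Fin.sum_univ_castSucc, Fin.lastCases_last, Fin.lastCases_castSucc, zero_mul,
      Finset.sum_const_zero, add_zero, zero_add, one_mul, mul_add]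
    have h1 : min lam 1 * ∑ i : Fin m, ξ i.castSucc ^ 2 ≤ lam * ∑ i : Fin m, ξ i.castSucc ^ 2 := by
      gcongr
      exact min_le_left _ _
    have h2 : min lam 1 * ξ (Fin.last m) ^ 2 ≤ 1 * ξ (Fin.last m) ^ 2 := by
      gcongr
      exact min_le_right _ _
    linarith [(key ξ).1]
  · intro ξ
    simp only [Fin.sum_univ_castSucc, Fin.lastCases_last, Fin.lastCases_castSucc, zero_mul,
      Finset.sum_const_zero, add_zero, zero_add, one_mul, mul_add]
    have h1 : Lam * ∑ i : Fin m, ξ i.castSucc ^ 2 ≤ max Lam 1 * ∑ i : Fin m, ξ i.castSucc ^ 2 := by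
      gcongr
      exact le_max_left _ _
    have h2 : 1 * ξ (Fin.last m) ^ 2 ≤ max Lam 1 * ξ (Fin.last m) ^ 2 := by
      gcongr
      exact le_max_right _ _
    linarith [(key ξ).2]

theorem degOp_lastCases {m : ℕ} (a : Fin m → Fin m → ℝ) (b : ℝ)
    (w : EuclideanSpace ℝ (Fin (m + 1)) → ℝ) (x : EuclideanSpace ℝ (Fin (m + 1))) :
    degOp (Fin.last m) (fun i j : Fin (m + 1) =>
      Fin.lastCases (motive := fun _ => ℝ) (Fin.lastCases (motive := fun _ => ℝ) 1 (fun _ => 0) j)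
        (fun i => Fin.lastCases (motive := fun _ => ℝ) 0 (fun j => a i j) j) i) b w x =
      fderiv ℝ (fderiv ℝ w) x (EuclideanSpace.single (Fin.last m) 1)
        (EuclideanSpace.single (Fin.last m) 1)
      + b * fderiv ℝ w x (EuclideanSpace.single (Fin.last m) 1) / x (Fin.last m)
      + ∑ i, ∑ j, a i j * fderiv ℝ (fderiv ℝ w) x (EuclideanSpace.single (Fin.castSucc i) 1)
        (EuclideanSpace.single (Fin.castSucc j) 1) := by
  simp only [degOp, Fin.sum_univ_castSucc, Fin.lastCases_last, Fin.lastCases_castSucc, zero_mul,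
    Finset.sum_const_zero, add_zero, zero_add, one_mul]
  ring

end Main

end DegenerateHolder

/-- **Hölder estimate for a degenerate linear equation** (a variant of
De Silva–Savin, Theorem 7.3): solutions of
`w_{nn} + b w_n / x_n + Σ a^{ij} w_{ij} = 0` in `B₁⁺` with uniformly elliptic `(a^{ij})`
and `1 < b₀ ≤ b ≤ b₁` satisfy an interior Hölder estimate up to `{x_n = 0}`. -/
theorem holder_estimate_degenerate_equation
    (n : ℕ) (hn : 2 ≤ n) (lam Lam b₀ b₁ : ℝ)
    (hlam : 0 < lam) (hlL : lam ≤ Lam) (hb₀ : 1 < b₀) (hb : b₀ ≤ b₁) :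
    ∃ α C : ℝ, α ∈ Set.Ioo (0 : ℝ) 1 ∧ 0 < C ∧
      ∀ (b : ℝ) (a : EuclideanSpace ℝ (Fin n) → Fin (n - 1) → Fin (n - 1) → ℝ)
        (w : EuclideanSpace ℝ (Fin n) → ℝ) (M : ℝ),
        b₀ ≤ b → b ≤ b₁ →
        -- uniform ellipticity of (a^{ij})
        (∀ x ∈ Metric.ball (0 : EuclideanSpace ℝ (Fin n)) 1 ∩ {x | 0 < lastCoord x},
          ∀ ξ : EuclideanSpace ℝ (Fin (n - 1)),
            lam * ‖ξ‖ ^ 2 ≤ ∑ i, ∑ j, a x i j * ξ i * ξ j ∧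
              ∑ i, ∑ j, a x i j * ξ i * ξ j ≤ Lam * ‖ξ‖ ^ 2) →
        -- w is bounded and C² on B₁⁺
        (∀ x ∈ Metric.ball (0 : EuclideanSpace ℝ (Fin n)) 1 ∩ {x | 0 < lastCoord x},
          |w x| ≤ M) →
        ContDiffOn ℝ 2 w
          (Metric.ball (0 : EuclideanSpace ℝ (Fin n)) 1 ∩ {x | 0 < lastCoord x}) →
        -- the equation
        (∀ x ∈ Metric.ball (0 : EuclideanSpace ℝ (Fin n)) 1 ∩ {x | 0 < lastCoord x},
          fderiv ℝ (fderiv ℝ w) x (eLast n) (eLast n)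
            + b * fderiv ℝ w x (eLast n) / lastCoord x
            + ∑ i, ∑ j, a x i j * fderiv ℝ (fderiv ℝ w) x (eTang n i) (eTang n j) = 0) →
        -- conclusion: interior Hölder continuity up to {x_n = 0}
        ∀ x ∈ Metric.ball (0 : EuclideanSpace ℝ (Fin n)) 1 ∩ {x | 0 < lastCoord x},
          ∀ y ∈ Metric.ball (0 : EuclideanSpace ℝ (Fin n)) 1 ∩ {x | 0 < lastCoord x},
            ‖x‖ ≤ 1 / 2 → ‖y‖ ≤ 1 / 2 →
              |w x - w y| ≤ C * M * ‖x - y‖ ^ α := by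
  obtain ⟨m, rfl⟩ : ∃ m, n = m + 1 := ⟨n - 1, by omega⟩
  have hlast : ∀ x : EuclideanSpace ℝ (Fin (m + 1)), lastCoord x = x (Fin.last m) := fun x => by
    simp [lastCoord, Fin.last]
  have heLast : eLast (m + 1) = EuclideanSpace.single (Fin.last m) 1 := by
    simp [eLast, Fin.last]
  obtain ⟨α, C, hα, hC, h⟩ := DegenerateHolder.exists_holder_constants (Fin.last m)
    (l := min lam 1) (L := max Lam 1) (lt_min hlam one_pos)
    (lt_max_of_lt_right one_pos) (hb₀.trans_le hb)
  refine ⟨α, C, hα, hC, ?_⟩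
  intro b a w M hb' hb'' ha hM hw heq x hx y hy hx2 hy2
  simp only [hlast, heLast] at ha hM hw heq hx hy
  refine h b w M (hb₀.trans_le hb') hb'' ⟨hw, fun z hz => ?_⟩ (fun z hz hzk => hM z ⟨hz, hzk⟩)
    x y hx.2 hy.2 hx2 hy2
  exact ⟨_, DegenerateHolder.isElliptic_lastCases (m := m) (a z) (ha z hz), by simp,
    (DegenerateHolder.degOp_lastCases (m := m) (a z) b w z).trans (heq z hz)⟩
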